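/- There exists a constant c = c(r) ∈ ℕ depending only on r such that whenever p > c the following holds: for every nonzero prime ideal 𝔩 of A with 𝔩 ≠ (T), the mod 𝔩 Galois representation of φ is surjective; that is, every 𝔽_𝔩-linear automorphism of φ[𝔩] is the restriction of some σ ∈ Gal(F̄/F) (equivalently, ρ̄_{φ,𝔩} : Gal(F^sep/F) → Aut(φ[𝔩]) ≅ GL_r(𝔽_𝔩) is surjective). -/

import Mathlib

open Polynomial

noncomputable section

/-- `F̄`: a fixed algebraic closure of `F = 𝔽_q(T)`. -/
abbrev Kbar (Fq : Type) [Field Fq] := AlgebraicClosure (RatFunc Fq)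

/-- `φ` is (encodes) the rank-`r` Drinfeld `𝔽_q[T]`-module over `𝔽_q(T)` given by
`φ_T = T + τ^{r-1} + T^{q-1} τ^r`: it is a ring homomorphism from `A = 𝔽_q[T]` to the
additive endomorphisms of `F̄` which is `𝔽_q`-linear (the condition on `C c`) and sends
`T` to `x ↦ T·x + x^{q^{r-1}} + T^{q-1}·x^{q^r}`. -/
def IsDrinfeldPhi (Fq : Type) [Field Fq] (q r : ℕ)
    (φ : Polynomial Fq →+* AddMonoid.End (Kbar Fq)) : Prop :=
  (∀ (c : Fq) (x : Kbar Fq),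
      φ (C c) x = algebraMap (RatFunc Fq) (Kbar Fq) (RatFunc.C c) * x) ∧
  (∀ x : Kbar Fq, φ X x =
      algebraMap (RatFunc Fq) (Kbar Fq) RatFunc.X * x + x ^ q ^ (r - 1) +
        algebraMap (RatFunc Fq) (Kbar Fq) RatFunc.X ^ (q - 1) * x ^ q ^ r)

/-- The `a`-torsion `φ[a] ⊆ F̄`. -/
def phiTorsion (Fq : Type) [Field Fq] (φ : Polynomial Fq →+* AddMonoid.End (Kbar Fq))
    (a : Polynomial Fq) : Set (Kbar Fq) := {x | φ a x = 0}

/-- `g` is an `A/(a)`-module automorphism of `φ[a]`: a bijection of `φ[a]` with itself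
which is additive and commutes with the `A`-action through `φ`. -/
def IsTorsionAut (Fq : Type) [Field Fq] (φ : Polynomial Fq →+* AddMonoid.End (Kbar Fq))
    (a : Polynomial Fq) (g : Kbar Fq → Kbar Fq) : Prop :=
  Set.BijOn g (phiTorsion Fq φ a) (phiTorsion Fq φ a) ∧
  (∀ x ∈ phiTorsion Fq φ a, ∀ y ∈ phiTorsion Fq φ a, g (x + y) = g x + g y) ∧
  (∀ b : Polynomial Fq, ∀ x ∈ phiTorsion Fq φ a, g (φ b x) = φ b (g x))

section CommutingTransitive

open Module

variable {K U : Type*} [Field K] [Finite K] [AddCommGroup U] [Module K U] [Module.Finite K U]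

/-- A commuting family of linear automorphisms of a finite vector space which is transitive on
nonzero vectors has full determinant: it generates a field, on which the determinant is the norm. -/
theorem exists_det_eq_of_commute_of_transitive (S : Set (Module.End K U))
    (hcomm : ∀ s ∈ S, ∀ t ∈ S, s * t = t * s) (hinj : ∀ s ∈ S, Function.Injective s)
    {x₀ : U} (hx₀ : x₀ ≠ 0) (htrans : ∀ y : U, y ≠ 0 → ∃ s ∈ S, s x₀ = y) {a : K} (ha : a ≠ 0) :
    ∃ s ∈ S, LinearMap.det s = a := by
  let R := Algebra.adjoin K S
  have hR : IsMulCommutative R := Algebra.isMulCommutative_adjoin K hcomm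
  let : CommRing R := { (inferInstance : Ring R) with mul_comm := hR.is_comm.comm }
  have hev : ∀ r : R, (r : Module.End K U) x₀ = 0 → r = 0 := by
    intro r hr
    ext y
    rcases eq_or_ne y 0 with rfl | hy
    · simp
    obtain ⟨s, hs, rfl⟩ := htrans y hy
    have h := congrArg (fun t : R => (t : Module.End K U) x₀)
      (mul_comm r ⟨s, Algebra.subset_adjoin hs⟩)
    simpa [hr] using h
  have hS : ∀ r : R, r ≠ 0 → (r : Module.End K U) ∈ S := by
    intro r hr
    obtain ⟨s, hs, hsx⟩ := htrans _ (fun h => hr (hev r h))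
    have : r - ⟨s, Algebra.subset_adjoin hs⟩ = 0 := by
      apply hev
      simp [hsx]
    rw [sub_eq_zero.1 this]
    exact hs
  have : Finite U := Module.finite_of_finite K
  have : Finite (Module.End K U) := Module.finite_of_finite K
  have : Finite R := Subtype.finite
  have : Nontrivial U := ⟨x₀, 0, hx₀⟩
  have : NoZeroDivisors R := by
    refine ⟨fun {r r'} h => ?_⟩
    by_contra! hne
    refine hne.2 (hev _ (hinj _ (hS r hne.1) ?_))
    simpa using congrArg (fun t : R => (t : Module.End K U) x₀) h
  have : IsDomain R := NoZeroDivisors.to_isDomain R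
  let : Field R := (Finite.isField_of_domain R).toField
  let ε : R →ₗ[K] U := (LinearMap.applyₗ x₀) ∘ₗ R.val.toLinearMap
  have hεb : Function.Bijective ε := by
    constructor
    · exact (injective_iff_map_eq_zero ε).2 fun r hr => hev r hr
    · intro y
      rcases eq_or_ne y 0 with rfl | hy
      · exact ⟨0, map_zero _⟩
      obtain ⟨s, hs, rfl⟩ := htrans y hy
      exact ⟨⟨s, Algebra.subset_adjoin hs⟩, rfl⟩
  obtain ⟨r, hr⟩ := FiniteField.norm_surjective K R a
  have hr0 : r ≠ 0 := by
    rintro rfl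
    exact ha (by rw [← hr, Algebra.norm_zero])
  refine ⟨r, hS r hr0, ?_⟩
  rw [← hr, Algebra.norm_apply, ← LinearMap.det_conj _ (LinearEquiv.ofBijective ε hεb)]
  congr 1
  ext y
  obtain ⟨t, rfl⟩ := hεb.2 y
  have h1 : (LinearEquiv.ofBijective ε hεb).symm (ε t) = t :=
    (LinearEquiv.symm_apply_eq _).2 rfl
  simp only [LinearMap.comp_apply, LinearEquiv.coe_coe]
  rw [h1]
  rfl

end CommutingTransitive

section Transvections

open Module LinearEquiv

variable {K V : Type*} [Field K] [AddCommGroup V] [Module K V]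

/-- A transvection fixing `U` pointwise and moving `y` to `v`, when `v` and `y` are independent
modulo `U`. -/
theorem exists_transvection_apply_eq {U : Submodule K V} {y v : V}
    (h : y ∉ U ⊔ K ∙ (v - y)) :
    ∃ t ∈ transvections K V, (∀ u ∈ U, t u = u) ∧ t y = v := by
  obtain ⟨f, hfy, hf⟩ := Submodule.exists_le_ker_of_notMem h
  have hfv : f (v - y) = 0 := hf (Submodule.mem_sup_right (Submodule.mem_span_singleton_self _))
  have hfU : ∀ u ∈ U, f u = 0 := fun u hu => hf (Submodule.mem_sup_left hu)
  have hg : f ((f y)⁻¹ • (v - y)) = 0 := by simp [hfv]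
  refine ⟨transvection hg, mem_transvections hg, fun u hu => ?_, ?_⟩
  · simp [LinearMap.transvection.apply, hfU u hu]
  · simp [LinearMap.transvection.apply, smul_smul, mul_inv_cancel₀ hfy]

theorem mem_of_transvections_of_det_eq_one [FiniteDimensional K V] (G : Subgroup (V ≃ₗ[K] V))
    (hG : ∀ e ∈ transvections K V, e ∈ G) (e : V ≃ₗ[K] V) (he : LinearEquiv.det e = 1) :
    e ∈ G := by
  induction hn : finrank K (V ⧸ e.fixedSubmodule) using Nat.strong_induction_on generalizing e with
  | _ n ih =>
  have hdet : ∀ t ∈ transvections K V, LinearEquiv.det t = 1 := by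
    rintro _ ⟨f, v, hfv, rfl⟩
    exact LinearEquiv.transvection.det_eq_one ..
  rcases le_or_gt n 1 with h1 | h1
  · obtain ⟨f, v, hfv⟩ := mem_dilatransvections_iff_finrank_quotient.mpr (hn ▸ h1)
    have hd : LinearMap.det (e : V →ₗ[K] V) = 1 := by
      rw [← LinearEquiv.coe_det, he]; rfl
    rw [hfv, LinearMap.transvection.det] at hd
    have h0 : f v = 0 := by linear_combination hd
    refine hG e ⟨f, v, h0, ?_⟩
    ext x
    exact congrArg (· x) hfv
  · set U := e.fixedSubmodule with hU
    have hUtop : U ≠ ⊤ := by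
      intro h
      have := Submodule.finrank_quotient_add_finrank U
      rw [h, finrank_top] at this
      rw [h] at hn
      omega
    obtain ⟨v, -, hv⟩ := SetLike.exists_of_lt (lt_top_iff_ne_top.mpr hUtop)
    have hlt : U ⊔ K ∙ v < ⊤ := sup_span_singleton_lt_top v (hn ▸ h1)
    obtain ⟨z, -, hz⟩ := SetLike.exists_of_lt hlt
    have hmemU : ∀ x, x ∈ U ↔ e x = x := fun x => LinearMap.mem_fixedSubmodule_iff
    have hev : e v ∉ U := by
      intro h
      have := (hmemU _).1 h
      exact hv ((hmemU _).2 (e.injective this))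
    -- it suffices to move `e v` to `v` while fixing `U`
    have key : (∃ t ∈ G, LinearEquiv.det t = 1 ∧ (∀ u ∈ U, t u = u) ∧ t (e v) = v) → e ∈ G := by
      rintro ⟨t, htG, htd, htU, htv⟩
      have : t * e ∈ G := by
        refine ih _ ?_ (t * e) (by rw [map_mul, htd, he, one_mul]) rfl
        rw [← hn]
        have hle : U ⊔ K ∙ v ≤ (t * e).fixedSubmodule := by
          refine sup_le (fun u hu => ?_) ?_
          · rw [LinearMap.mem_fixedSubmodule_iff, LinearEquiv.coe_coe, LinearEquiv.mul_apply,
              (hmemU u).1 hu, htU u hu]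
          · rw [Submodule.span_singleton_le_iff_mem, LinearMap.mem_fixedSubmodule_iff,
              LinearEquiv.coe_coe, LinearEquiv.mul_apply, htv]
        have h2 := finrank_quotient_sup_span_singleton hv
        have h3 := Submodule.finrank_quotient_add_finrank (t * e).fixedSubmodule
        have h4 := Submodule.finrank_quotient_add_finrank (U ⊔ K ∙ v)
        have h5 := Submodule.finrank_mono hle
        omega
      simpa using G.mul_mem (G.inv_mem htG) this
    by_cases hc : e v ∈ U ⊔ K ∙ (v - e v)
    · have hev' : e v ∈ U ⊔ K ∙ v := by
        obtain ⟨u, hu, w, hw, huw⟩ := Submodule.mem_sup.1 hc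
        obtain ⟨c, rfl⟩ := Submodule.mem_span_singleton.1 hw
        have hc1 : (1 + c) • e v = u + c • v := by
          have : e v + c • e v = (u + c • (v - e v)) + c • e v := by rw [huw]
          rw [add_smul, one_smul, this, smul_sub]; abel
        by_cases h0 : 1 + c = 0
        · exfalso
          rw [h0, zero_smul] at hc1
          have hc' : c = -1 := by linear_combination h0
          apply hv
          have : v = u := by
            rw [hc', neg_smul, one_smul] at hc1
            exact (add_neg_eq_zero.1 hc1.symm).symm
          rw [this]; exact hu
        · have : e v = (1 + c)⁻¹ • (u + c • v) := by
            rw [← hc1, smul_smul,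
              inv_mul_cancel₀ h0, one_smul]
          rw [this]
          exact Submodule.smul_mem _ _ (Submodule.add_mem _ (Submodule.mem_sup_left hu)
            (Submodule.smul_mem _ _ (Submodule.mem_sup_right (Submodule.mem_span_singleton_self v))))
      have hind : ∀ a ∈ U ⊔ K ∙ v, a ∉ U → a ∉ U ⊔ K ∙ (z - a) := by
        intro a ha haU h
        obtain ⟨u, hu, w, hw, huw⟩ := Submodule.mem_sup.1 h
        obtain ⟨c, rfl⟩ := Submodule.mem_span_singleton.1 hw
        by_cases h0 : c = 0
        · rw [h0, zero_smul, add_zero] at huw; exact haU (huw ▸ hu)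
        · apply hz
          have : z = c⁻¹ • ((a - u) + c • a) := by
            rw [← huw, add_sub_cancel_left, huw, smul_sub, sub_add_cancel, smul_smul,
              inv_mul_cancel₀ h0, one_smul]
          rw [this]
          exact Submodule.smul_mem _ _ (Submodule.add_mem _
            (Submodule.sub_mem _ ha (Submodule.mem_sup_left hu)) (Submodule.smul_mem _ _ ha))
      obtain ⟨t₁, h₁, h₁U, h₁v⟩ := exists_transvection_apply_eq (hind _ hev' hev)
      have hvv := hind v (Submodule.mem_sup_right (Submodule.mem_span_singleton_self v)) hv
      obtain ⟨t₂, h₂, h₂U, h₂v⟩ := exists_transvection_apply_eq hvv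
      refine key ⟨t₂⁻¹ * t₁, G.mul_mem (G.inv_mem (hG _ h₂)) (hG _ h₁), ?_, fun u hu => ?_, ?_⟩
      · rw [map_mul, map_inv, hdet _ h₁, hdet _ h₂]; simp
      · rw [LinearEquiv.mul_apply, h₁U u hu]
        exact (LinearEquiv.symm_apply_eq t₂).2 (h₂U u hu).symm
      · rw [LinearEquiv.mul_apply, h₁v]
        exact (LinearEquiv.symm_apply_eq t₂).2 h₂v.symm
    · obtain ⟨t, h₁, h₁U, h₁v⟩ := exists_transvection_apply_eq hc
      exact key ⟨t, hG _ h₁, hdet _ h₁, h₁U, h₁v⟩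

theorem transvection_comp_eq_conj {f : Dual K V} (g : V ≃ₗ[K] V) {w : V}
    (h : (f ∘ₗ (g : V →ₗ[K] V)) w = 0) :
    transvection h = g⁻¹ * transvection (f := f) (v := g w) h * g := by
  ext x
  simp [LinearMap.transvection.apply, LinearEquiv.mul_apply, LinearEquiv.coe_inv]

/-- A subgroup of `GL(V)` which contains all transvections along one hyperplane `ker f`, stabilizes
no nonzero subspace of that hyperplane and has full determinant is everything. -/
theorem mem_of_transvections_along [FiniteDimensional K V] (G : Subgroup (V ≃ₗ[K] V))
    (f : Dual K V) (hf : ∀ (w : V) (h : f w = 0), transvection h ∈ G)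
    (hirr : ∀ M : Submodule K V, (∀ g ∈ G, ∀ x ∈ M, g x ∈ M) → M ≤ LinearMap.ker f → M = ⊥)
    (hdet : ∀ a : Kˣ, ∃ g ∈ G, LinearEquiv.det g = a) (e : V ≃ₗ[K] V) : e ∈ G := by
  let O : Submodule K (Dual K V) :=
    { carrier := {f' | ∀ (w : V) (h : f' w = 0), transvection h ∈ G}
      zero_mem' := fun w h => by
        rw [transvection.of_left_eq_zero]; exact G.one_mem
      smul_mem' := fun c f' hf' w h => by
        have hw : f' (c • w) = 0 := by simpa using h
        convert hf' _ hw using 1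
        ext x; simp [LinearMap.transvection.apply, smul_smul, mul_comm]
      add_mem' := fun {f₁ f₂} h₁ h₂ w h => by
        by_cases hk : LinearMap.ker f₁ ≤ LinearMap.ker f₂
        · obtain ⟨c, rfl⟩ : ∃ c : K, c • f₁ = f₂ := by
            have := mem_span_of_iInf_ker_le_ker (ι := Unit) (L := fun _ => f₁) (K := f₂)
              (by simpa using hk)
            simpa [Submodule.mem_span_singleton] using this
          have hw : f₁ ((1 + c) • w) = 0 := by
            simpa [add_mul] using h
          convert h₁ _ hw using 1
          ext x; simp [LinearMap.transvection.apply, smul_smul, add_smul, mul_comm]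
        · obtain ⟨u, hu₁, hu₂⟩ := Set.not_subset.1 hk
          have hu₁' : f₁ ((f₂ u)⁻¹ • u) = 0 := by simp [LinearMap.mem_ker.1 hu₁]
          have hcomp : f₁ + f₂ = f₂ ∘ₗ (transvection hu₁' : V →ₗ[K] V) := by
            ext x
            have : f₂ u ≠ 0 := hu₂
            simp [LinearMap.transvection.apply, inv_mul_cancel₀ this, add_comm]
          have h' := h
          rw [hcomp] at h'
          have : transvection h = transvection h' := by
            ext x; simp only [transvection.apply]; rw [hcomp]
          rw [this, transvection_comp_eq_conj]
          exact G.mul_mem (G.mul_mem (G.inv_mem (h₁ _ _)) (h₂ _ _)) (h₁ _ _) }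
  have hO : O.dualCoannihilator = ⊥ := by
    refine hirr _ (fun g hg x hx => ?_) (fun x hx => ?_)
    · rw [Submodule.mem_dualCoannihilator] at hx ⊢
      intro φ hφ
      refine hx (φ ∘ₗ (g : V →ₗ[K] V)) fun w h => ?_
      rw [transvection_comp_eq_conj]
      exact G.mul_mem (G.mul_mem (G.inv_mem hg) (hφ _ _)) hg
    · exact (Submodule.mem_dualCoannihilator _).1 hx f hf
  have hOtop : O = ⊤ := by
    rw [← Subspace.dualCoannihilator_dualAnnihilator_eq (W := O), hO, Submodule.dualAnnihilator_bot]
  obtain ⟨g, hg, hgd⟩ := hdet (LinearEquiv.det e)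
  have h1 : e * g⁻¹ ∈ G := by
    refine mem_of_transvections_of_det_eq_one G ?_ _ (by rw [map_mul, map_inv, hgd, mul_inv_cancel])
    rintro _ ⟨f', v, hfv, rfl⟩
    have : f' ∈ O := hOtop ▸ Submodule.mem_top
    exact this v hfv
  simpa using G.mul_mem h1 hg

end Transvections

section DrinfeldPolynomials

variable {Fq : Type} [Field Fq]

/-- The analogue of `IsDrinfeldPhi` over an arbitrary field `E` above `𝔽_q[T]`. -/
def IsDrinfeldOn {E : Type*} [Field E] [Algebra Fq[X] E] (q r : ℕ)
    (φ : Fq[X] →+* AddMonoid.End E) : Prop :=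
  (∀ (c : Fq) (x : E), φ (C c) x = algebraMap Fq[X] E (C c) * x) ∧
  (∀ x : E, φ X x = algebraMap Fq[X] E X * x + x ^ q ^ (r - 1) +
    algebraMap Fq[X] E X ^ (q - 1) * x ^ q ^ r)

variable (Fq) in
/-- The polynomial inducing `φ_{T^n}`. -/
def powPoly (q r : ℕ) : ℕ → Fq[X][X]
  | 0 => X
  | n + 1 => C X * powPoly q r n + powPoly q r n ^ q ^ (r - 1) +
      C (X ^ (q - 1)) * powPoly q r n ^ q ^ r

/-- The polynomial inducing `φ_a`. -/
def phiPoly (q r : ℕ) (a : Fq[X]) : Fq[X][X] :=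
  ∑ i ∈ Finset.range (a.natDegree + 1), C (C (a.coeff i)) * powPoly Fq q r i

section Aeval

variable {E : Type*} [Field E] [Algebra Fq[X] E] {q r : ℕ} {φ : Fq[X] →+* AddMonoid.End E}

theorem phi_mul (a b : Fq[X]) (x : E) : φ (a * b) x = φ a (φ b x) := by
  rw [map_mul]; rfl

theorem phi_add (a b : Fq[X]) (x : E) : φ (a + b) x = φ a x + φ b x := by
  rw [map_add]; rfl

theorem phi_sub (a b : Fq[X]) (x : E) : φ (a - b) x = φ a x - φ b x := by
  rw [map_sub]; rfl

theorem phi_zero (x : E) : φ 0 x = 0 := by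
  rw [map_zero]; rfl

theorem phi_one (x : E) : φ 1 x = x := by
  rw [map_one]; rfl

theorem phi_sum {ι : Type*} (s : Finset ι) (f : ι → Fq[X]) (x : E) :
    φ (∑ i ∈ s, f i) x = ∑ i ∈ s, φ (f i) x := by
  classical
  induction s using Finset.induction_on with
  | empty => simp
  | insert i s hi ih => rw [Finset.sum_insert hi, Finset.sum_insert hi, phi_add, ih]

theorem phi_phi_eq_zero {l : Fq[X]} {x : E} (hx : φ l x = 0) (a : Fq[X]) :
    φ l (φ a x) = 0 := by
  rw [← phi_mul, mul_comm, phi_mul, hx, map_zero]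

theorem aeval_powPoly (hφ : IsDrinfeldOn q r φ) (n : ℕ) (x : E) :
    aeval x (powPoly Fq q r n) = φ (X ^ n) x := by
  induction n with
  | zero => simp [powPoly]
  | succ n ih =>
    rw [pow_succ', phi_mul, hφ.2, ← ih]
    simp [powPoly]

theorem aeval_phiPoly (hφ : IsDrinfeldOn q r φ) (a : Fq[X]) (x : E) :
    aeval x (phiPoly q r a) = φ a x := by
  conv_rhs => rw [a.as_sum_range_C_mul_X_pow]
  rw [phiPoly, map_sum, phi_sum]
  refine Finset.sum_congr rfl fun i _ => ?_
  rw [map_mul, phi_mul, hφ.1, aeval_powPoly hφ, aeval_C]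

end Aeval

theorem coeff_zero_powPoly {q r : ℕ} (hq : q ≠ 0) (n : ℕ) : (powPoly Fq q r n).coeff 0 = 0 := by
  rw [coeff_zero_eq_eval_zero]
  induction n with
  | zero => simp [powPoly]
  | succ n ih => simp [powPoly, ih, hq]

theorem coeff_zero_phiPoly {q r : ℕ} (hq : q ≠ 0) (a : Fq[X]) : (phiPoly q r a).coeff 0 = 0 := by
  rw [phiPoly, finsetSum_coeff]
  exact Finset.sum_eq_zero fun i _ => by rw [coeff_C_mul, coeff_zero_powPoly hq, mul_zero]

theorem derivative_powPoly {q r : ℕ} (hq : (q : Fq) = 0) (hr : 2 ≤ r) (n : ℕ) :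
    derivative (powPoly Fq q r n) = C (X ^ n) := by
  have h0 : ∀ m : ℕ, m ≠ 0 → ((q ^ m : ℕ) : Fq[X][X]) = 0 := fun m hm => by
    have : (q : Fq[X][X]) = 0 := by
      rw [← map_natCast (C.comp C : Fq →+* Fq[X][X]), hq, map_zero]
    rw [Nat.cast_pow, this, zero_pow hm]
  induction n with
  | zero => simp [powPoly]
  | succ n ih =>
    simp only [powPoly, derivative_add, derivative_mul, derivative_C, ih, derivative_pow]
    have h1 := h0 (r - 1) (by omega)
    have h2 := h0 r (by omega)
    rw [map_natCast, map_natCast, h1, h2]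
    simp [pow_succ']

theorem derivative_phiPoly {q r : ℕ} (hq : (q : Fq) = 0) (hr : 2 ≤ r) (a : Fq[X]) :
    derivative (phiPoly q r a) = C a := by
  conv_rhs => rw [a.as_sum_range_C_mul_X_pow]
  rw [phiPoly, derivative_sum, map_sum]
  refine Finset.sum_congr rfl fun i _ => ?_
  rw [derivative_C_mul, derivative_powPoly hq hr, C_mul]

theorem coeff_one_phiPoly {q r : ℕ} (hq : (q : Fq) = 0) (hr : 2 ≤ r) (a : Fq[X]) :
    (phiPoly q r a).coeff 1 = a := by
  have := congrArg (coeff · 0) (derivative_phiPoly hq hr a)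
  simpa [coeff_derivative] using this

theorem natDegree_powPoly_leadingCoeff {q r : ℕ} (hq : 2 ≤ q) (hr : 1 ≤ r) (n : ℕ) :
    (powPoly Fq q r n).natDegree = q ^ (r * n) ∧
      ∃ M : ℕ, (powPoly Fq q r n).leadingCoeff = X ^ M := by
  induction n with
  | zero => exact ⟨by simp [powPoly], 0, by simp [powPoly]⟩
  | succ n ih =>
    obtain ⟨hd, M, hM⟩ := ih
    have hpos : 0 < q ^ (r * n) := by positivity
    have hlt : q ^ (r - 1) < q ^ r := Nat.pow_lt_pow_right (by omega) (by omega)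
    have h1 : 1 ≤ q ^ (r - 1) := Nat.one_le_pow _ _ (by omega)
    have hX : (X ^ (q - 1) : Fq[X]) ≠ 0 := pow_ne_zero _ X_ne_zero
    have hd3 : (C (X ^ (q - 1) : Fq[X]) * powPoly Fq q r n ^ q ^ r).natDegree =
        q ^ r * q ^ (r * n) := by
      rw [natDegree_C_mul hX, natDegree_pow, hd]
    have hd12 : (C X * powPoly Fq q r n + powPoly Fq q r n ^ q ^ (r - 1)).natDegree <
        (C (X ^ (q - 1) : Fq[X]) * powPoly Fq q r n ^ q ^ r).natDegree := by
      rw [hd3]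
      refine (natDegree_add_le _ _).trans_lt (max_lt ?_ ?_)
      · rw [natDegree_C_mul X_ne_zero, hd]
        exact lt_mul_of_one_lt_left hpos (h1.trans_lt hlt)
      · rw [natDegree_pow, hd]
        exact Nat.mul_lt_mul_of_pos_right hlt hpos
    refine ⟨?_, q - 1 + M * q ^ r, ?_⟩
    · rw [powPoly, natDegree_add_eq_right_of_natDegree_lt hd12, hd3, ← pow_add, Nat.mul_succ,
        Nat.add_comm]
    · rw [powPoly, leadingCoeff_add_of_degree_lt (degree_lt_degree hd12), leadingCoeff_mul,
        leadingCoeff_C, leadingCoeff_pow, hM, ← pow_mul, ← pow_add]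

theorem natDegree_phiPoly_leadingCoeff {q r : ℕ} (hq : 2 ≤ q) (hr : 1 ≤ r) {l : Fq[X]}
    (hl : l.Monic) :
    (phiPoly q r l).natDegree = q ^ (r * l.natDegree) ∧
      ∃ M : ℕ, (phiPoly q r l).leadingCoeff = X ^ M := by
  obtain ⟨hd, M, hM⟩ := natDegree_powPoly_leadingCoeff (Fq := Fq) hq hr l.natDegree
  have hlow : (∑ i ∈ Finset.range l.natDegree, C (C (l.coeff i)) * powPoly Fq q r i).degree <
      (powPoly Fq q r l.natDegree).degree := by
    have hne : powPoly Fq q r l.natDegree ≠ 0 := by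
      intro h
      rw [h, natDegree_zero] at hd
      have : 0 < q ^ (r * l.natDegree) := by positivity
      omega
    refine (degree_sum_le _ _).trans_lt ((Finset.sup_lt_iff (bot_lt_iff_ne_bot.2
      (degree_ne_bot.2 hne))).2 fun i hi => ?_)
    refine degree_lt_degree ((natDegree_C_mul_le _ _).trans_lt ?_)
    rw [(natDegree_powPoly_leadingCoeff hq hr i).1, hd]
    exact Nat.pow_lt_pow_right (by omega)
      (Nat.mul_lt_mul_of_pos_left (Finset.mem_range.1 hi) (by omega))
  have heq : phiPoly q r l = (∑ i ∈ Finset.range l.natDegree,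
      C (C (l.coeff i)) * powPoly Fq q r i) + powPoly Fq q r l.natDegree := by
    rw [phiPoly, Finset.sum_range_succ, coeff_natDegree, hl, C_1, C_1, one_mul]
  rw [heq, leadingCoeff_add_of_degree_lt hlow, natDegree_add_eq_right_of_degree_lt hlow]
  exact ⟨hd, M, hM⟩

end DrinfeldPolynomials

section Valuations

variable {Fq : Type} [Field Fq] [Fintype Fq] {E : Type*} [Field E] [Algebra Fq[X] E]
  {Γ₀ : Type*} [LinearOrderedCommGroupWithZero Γ₀] (v : Valuation E Γ₀)
  {q r : ℕ} {φ : Fq[X] →+* AddMonoid.End E}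

theorem valuation_const {c : Fq} (hc : c ≠ 0) : v (algebraMap Fq[X] E (C c)) = 1 := by
  have h1 : v (algebraMap Fq[X] E (C c)) ^ (Fintype.card Fq - 1) = 1 := by
    rw [← map_pow, ← map_pow, ← map_pow, FiniteField.pow_card_sub_one_eq_one c hc]
    simp
  exact (pow_eq_one_iff_of_nonneg zero_le (by have := Fintype.one_lt_card (α := Fq); omega)).1 h1

theorem valuation_const_le (c : Fq) : v (algebraMap Fq[X] E (C c)) ≤ 1 := by
  rcases eq_or_ne c 0 with rfl | hc
  · simp
  · exact (valuation_const v hc).le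

theorem valuation_algebraMap_le (ht : v (algebraMap Fq[X] E X) ≤ 1) (a : Fq[X]) :
    v (algebraMap Fq[X] E a) ≤ 1 := by
  rw [a.as_sum_range_C_mul_X_pow, map_sum]
  refine v.map_sum_le fun i _ => ?_
  rw [map_mul, map_pow, map_mul, map_pow]
  exact mul_le_one' (valuation_const_le v _) (pow_le_one' ht i)

theorem valuation_aeval_le (ht : v (algebraMap Fq[X] E X) ≤ 1) {x : E} (hx : v x ≤ 1)
    (P : Fq[X][X]) : v (aeval x P) ≤ 1 := by
  rw [aeval_eq_sum_range]
  refine v.map_sum_le fun i _ => ?_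
  rw [Algebra.smul_def, map_mul, map_pow]
  exact mul_le_one' (valuation_algebraMap_le v ht _) (pow_le_one' hx i)

theorem valuation_phi_le (hφ : IsDrinfeldOn q r φ) (ht : v (algebraMap Fq[X] E X) ≤ 1) {x : E}
    (hx : v x ≤ 1) (a : Fq[X]) : v (φ a x) ≤ 1 := by
  rw [← aeval_phiPoly hφ]
  exact valuation_aeval_le v ht hx _

theorem valuation_phi_const (hφ : IsDrinfeldOn q r φ) {c : Fq} (hc : c ≠ 0) (x : E) :
    v (φ (C c) x) = v x := by
  rw [hφ.1, map_mul, valuation_const v hc, one_mul]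

/-- Vectors with growing orbit are not torsion. -/
theorem phi_ne_zero_of_growing (hφ : IsDrinfeldOn q r φ) {x : E}
    (hx : ∀ i, v (φ (X ^ i) x) < v (φ (X ^ (i + 1)) x)) {a : Fq[X]} (ha : a ≠ 0) :
    φ a x ≠ 0 := by
  have hmono : StrictMono fun i => v (φ (X ^ i) x) := strictMono_nat_of_lt_succ hx
  have hle : ∀ (c : Fq) i, v (φ (C c * X ^ i) x) ≤ v (φ (X ^ i) x) := by
    intro c i
    rw [phi_mul, hφ.1, map_mul]
    exact mul_le_of_le_one_left' (valuation_const_le v c)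
  have hpos : v (φ (X ^ a.natDegree) x) ≠ 0 := by
    intro h
    have h1 := hx a.natDegree
    rw [pow_succ', phi_mul, (v.zero_iff.1 h), map_zero, map_zero] at h1
    simp at h1
  have hsum : v (φ a x) = v (φ (X ^ a.natDegree) x) := by
    conv_lhs => rw [a.as_sum_range_C_mul_X_pow, phi_sum, Finset.sum_range_succ]
    have htop : v (φ (C (a.coeff a.natDegree) * X ^ a.natDegree) x) =
        v (φ (X ^ a.natDegree) x) := by
      rw [phi_mul, valuation_phi_const v hφ]
      rwa [coeff_natDegree, leadingCoeff_ne_zero]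
    rw [v.map_add_eq_of_lt_right, htop]
    rw [htop]
    exact v.map_sum_lt hpos fun i hi => (hle _ i).trans_lt (hmono (Finset.mem_range.1 hi))
  intro h
  rw [h, map_zero] at hsum
  exact hpos hsum.symm

theorem phi_ne_zero_of_invariant (hφ : IsDrinfeldOn q r φ) (P : E → Prop)
    (hP : ∀ x, P x → P (φ X x) ∧ v x < v (φ X x)) {x : E} (hx : P x) {a : Fq[X]} (ha : a ≠ 0) :
    φ a x ≠ 0 := by
  have h : ∀ i, P (φ (X ^ i) x) := by
    intro i
    induction i with
    | zero => simpa [phi_one] using hx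
    | succ i ih => rw [pow_succ', phi_mul]; exact (hP _ ih).1
  refine phi_ne_zero_of_growing v hφ (fun i => ?_) ha
  rw [pow_succ', phi_mul]
  exact (hP _ (h i)).2

/-- `φ_T x` as a linear term plus a factor times `x^N`. -/
theorem phi_X_eq (hφ : IsDrinfeldOn q r φ) (hq : 2 ≤ q) (hr : 2 ≤ r) (x : E) :
    φ X x = algebraMap Fq[X] E X * x +
      x ^ q ^ (r - 1) * (1 + (algebraMap Fq[X] E X * x ^ q ^ (r - 1)) ^ (q - 1)) := by
  have h1 : q ^ r = q ^ (r - 1) + q ^ (r - 1) * (q - 1) := by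
    obtain ⟨q, rfl⟩ := Nat.exists_eq_add_of_le' (show 1 ≤ q by omega)
    obtain ⟨r, rfl⟩ := Nat.exists_eq_add_of_le' (show 1 ≤ r by omega)
    simp only [Nat.add_sub_cancel]
    ring
  rw [hφ.2, h1, pow_add, pow_mul]
  ring

section Finite

variable (hφ : IsDrinfeldOn q r φ) (hq : 3 ≤ q) (hr : 2 ≤ r)
include hφ hq hr

theorem valuation_linear_lt {x : E} (ht : v (algebraMap Fq[X] E X) ≤ 1) (hx : 1 < v x) :
    v (algebraMap Fq[X] E X * x) < v x ^ q ^ (r - 1) := by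
  rw [map_mul]
  exact (mul_le_of_le_one_left' ht).trans_lt
    (lt_self_pow₀ hx (Nat.one_lt_pow (by omega) (by omega)))

theorem phi_ne_zero_of_one_lt {x : E} (ht : v (algebraMap Fq[X] E X) ≤ 1) (hx : 1 < v x)
    (hx' : 1 < v (algebraMap Fq[X] E X) * v x ^ q ^ (r - 1)) {a : Fq[X]} (ha : a ≠ 0) :
    φ a x ≠ 0 := by
  refine phi_ne_zero_of_invariant v hφ
    (fun x => 1 < v x ∧ 1 < v (algebraMap Fq[X] E X) * v x ^ q ^ (r - 1)) ?_ ⟨hx, hx'⟩ ha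
  rintro x ⟨hx, hx'⟩
  have hα : 1 < v ((algebraMap Fq[X] E X * x ^ q ^ (r - 1)) ^ (q - 1)) := by
    rw [map_pow, map_mul, map_pow]
    exact one_lt_pow₀ hx' (by omega)
  have h2 : v (1 + (algebraMap Fq[X] E X * x ^ q ^ (r - 1)) ^ (q - 1)) =
      v ((algebraMap Fq[X] E X * x ^ q ^ (r - 1)) ^ (q - 1)) :=
    v.map_add_eq_of_lt_right (by rwa [map_one])
  have hlin := valuation_linear_lt v hφ hq hr ht hx
  have hself : v x < v x ^ q ^ (r - 1) :=
    lt_self_pow₀ hx (Nat.one_lt_pow (by omega) (by omega))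
  have h3 : v x ^ q ^ (r - 1) <
      v (x ^ q ^ (r - 1) * (1 + (algebraMap Fq[X] E X * x ^ q ^ (r - 1)) ^ (q - 1))) := by
    rw [map_mul, h2, map_pow]
    exact lt_mul_of_one_lt_right (pow_pos (zero_lt_one.trans hx) _) hα
  have h4 : v x < v (φ X x) := by
    rw [phi_X_eq hφ (by omega) hr, v.map_add_eq_of_lt_right (hlin.trans h3)]
    exact hself.trans h3
  exact ⟨⟨hx.trans h4, hx'.trans_le (by gcongr)⟩, h4⟩

theorem valuation_le_one_of_phi_eq_zero {x : E} (ht : v (algebraMap Fq[X] E X) = 1) {a : Fq[X]}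
    (ha : a ≠ 0) (hx : φ a x = 0) : v x ≤ 1 := by
  by_contra! h
  refine phi_ne_zero_of_one_lt v hφ hq hr ht.le h ?_ ha hx
  rw [ht, one_mul]
  exact one_lt_pow₀ h (by positivity)

theorem valuation_mul_pow_le_one {x : E} (ht : v (algebraMap Fq[X] E X) ≤ 1) {a : Fq[X]}
    (ha : a ≠ 0) (hx : φ a x = 0) : v (algebraMap Fq[X] E X) * v x ^ q ^ (r - 1) ≤ 1 := by
  rcases le_or_gt (v x) 1 with h | h
  · exact mul_le_one' ht (pow_le_one' h _)
  · by_contra! h'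
    exact phi_ne_zero_of_one_lt v hφ hq hr ht h h' ha hx

/-- Torsion points are small at places above infinity. -/
theorem valuation_lt_one_of_phi_eq_zero {x : E} (ht : 1 < v (algebraMap Fq[X] E X)) {a : Fq[X]}
    (ha : a ≠ 0) (hx : φ a x = 0) : v x < 1 := by
  by_contra! h
  refine phi_ne_zero_of_invariant v hφ (fun x => 1 ≤ v x) ?_ h ha hx
  intro x hx
  have htq : v (algebraMap Fq[X] E X) < v (algebraMap Fq[X] E X) ^ (q - 1) :=
    lt_self_pow₀ ht (by omega)
  have hpow : ∀ n : ℕ, n ≠ 0 → v x ≤ v x ^ n := fun n hn => le_self_pow₀ hx hn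
  have hpos : 0 < v x := zero_lt_one.trans_le hx
  have htop : v (algebraMap Fq[X] E X ^ (q - 1) * x ^ q ^ r) =
      v (algebraMap Fq[X] E X) ^ (q - 1) * v x ^ q ^ r := by simp
  have h3 : v x < v (algebraMap Fq[X] E X) ^ (q - 1) * v x ^ q ^ r :=
    (hpow (q ^ r) (by positivity)).trans_lt
      (lt_mul_of_one_lt_left (pow_pos hpos _) (ht.trans htq))
  have h4 : v (φ X x) = v (algebraMap Fq[X] E X) ^ (q - 1) * v x ^ q ^ r := by
    rw [hφ.2, v.map_add_eq_of_lt_right, htop]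
    rw [htop]
    refine v.map_add_lt ?_ ?_
    · rw [map_mul]
      exact mul_lt_mul htq (hpow _ (by positivity)) hpos zero_le
    · rw [map_pow]
      calc v x ^ q ^ (r - 1) ≤ v x ^ q ^ r :=
            pow_le_pow_right₀ hx (Nat.pow_le_pow_right (by omega) (by omega))
        _ < _ := lt_mul_of_one_lt_left (pow_pos hpos _) (ht.trans htq)
  rw [h4]
  exact ⟨hx.trans h3.le, h3⟩

/-- A torsion point which is not integral at `T` has a level. -/
theorem exists_level {x : E} (ht : v (algebraMap Fq[X] E X) ≤ 1) {l : Fq[X]} (hl : l ≠ 0)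
    (hx : φ l x = 0) (hx1 : 1 < v x) :
    ∃ m, 1 ≤ m ∧ v (algebraMap Fq[X] E X) * v x ^ (q ^ (r - 1)) ^ m = 1 ∧
      ∀ i < m, v (φ (X ^ i) x) = v x ^ (q ^ (r - 1)) ^ i := by
  have hN : 1 < q ^ (r - 1) := Nat.one_lt_pow (by omega) (by omega)
  by_contra! hno
  have key : ∀ i, ∀ j ≤ i, v (φ (X ^ j) x) = v x ^ (q ^ (r - 1)) ^ j := by
    intro i
    induction i with
    | zero =>
      intro j hj
      obtain rfl : j = 0 := by omega
      simp
    | succ i ih =>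
      intro j hj
      rcases Nat.lt_or_ge j (i + 1) with h | h
      · exact ih j (by omega)
      obtain rfl : j = i + 1 := by omega
      have hi := ih i le_rfl
      have hki : φ l (φ (X ^ i) x) = 0 := by
        rw [← phi_mul, mul_comm, phi_mul, hx, map_zero]
      have hle := valuation_mul_pow_le_one v hφ hq hr ht hl hki
      rw [hi, ← pow_mul, ← pow_succ] at hle
      have hne : v (algebraMap Fq[X] E X) * v x ^ (q ^ (r - 1)) ^ (i + 1) ≠ 1 := by
        intro h
        obtain ⟨j, hj, hj'⟩ := hno (i + 1) (by omega) h
        exact hj' (ih j (by omega))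
      have hlt := lt_of_le_of_ne hle hne
      have h1 : 1 < v (φ (X ^ i) x) := by
        rw [hi]; exact one_lt_pow₀ hx1 (by positivity)
      have h2 : v (1 + (algebraMap Fq[X] E X * (φ (X ^ i) x) ^ q ^ (r - 1)) ^ (q - 1)) = 1 := by
        rw [v.map_add_eq_of_lt_left, map_one]
        rw [map_one, map_pow, map_mul, map_pow, hi, ← pow_mul, ← pow_succ]
        exact pow_lt_one₀ zero_le hlt (by omega)
      have hlin := valuation_linear_lt v hφ hq hr ht h1
      rw [← map_pow v, ← mul_one (v (_ ^ _)), ← h2, ← map_mul v (_ ^ _)] at hlin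
      rw [pow_succ' X i, phi_mul, phi_X_eq hφ (by omega) hr, v.map_add_eq_of_lt_right hlin,
        map_mul, h2, mul_one, map_pow, hi, ← pow_mul, ← pow_succ]
  refine phi_ne_zero_of_growing v hφ (fun i => ?_) hl hx
  rw [key i i le_rfl, key (i + 1) (i + 1) le_rfl]
  exact pow_lt_pow_right₀ hx1 (Nat.pow_lt_pow_right hN (by omega))

end Finite

theorem exists_const_valuation_sub_lt_one (hq : Fintype.card Fq = q) {k : ℕ} {u : E}
    (h : v (u ^ (q * q ^ k) - u ^ q ^ k) < 1) :
    ∃ c : Fq, v (u - algebraMap Fq[X] E (C c)) < 1 := by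
  obtain ⟨p, hp⟩ := CharP.exists Fq
  obtain ⟨n, hpp, hn⟩ := FiniteField.card Fq p
  have : Fact p.Prime := ⟨hpp⟩
  let ι : Fq →+* E := (algebraMap Fq[X] E).comp C
  have : CharP E p := charP_of_injective_ringHom ι.injective p
  have hpow : u ^ (q * q ^ k) - u ^ q ^ k = (u ^ q - u) ^ q ^ k := by
    rw [pow_mul, ← hq, hn, ← pow_mul, ← pow_mul p, sub_pow_expChar_pow, pow_mul]
  have hprod : u ^ q - u = ∏ c : Fq, (u - ι c) := by
    have h1 := FiniteField.roots_X_pow_card_sub_X Fq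
    have hdeg := FiniteField.X_pow_card_sub_X_natDegree_eq Fq (Fintype.one_lt_card (α := Fq))
    have hmonic : (X ^ Fintype.card Fq - X : Fq[X]).Monic :=
      monic_X_pow_sub (by rw [degree_X]; exact_mod_cast Fintype.one_lt_card)
    have h2 := prod_multiset_X_sub_C_of_monic_of_roots_card_eq hmonic
      (by rw [h1, hdeg]; rfl)
    rw [h1] at h2
    have h3 := congrArg (eval₂ ι u) h2
    rw [hq] at h3
    simp only [eval₂_sub, eval₂_pow, eval₂_X] at h3
    rw [← h3]
    change eval₂ ι u (∏ c : Fq, (X - C c)) = _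
    simp [eval₂_finsetProd]
  rw [hpow, map_pow, hprod, map_prod] at h
  by_contra! hc
  exact absurd h (not_lt.2 (one_le_pow₀ (Finset.one_le_prod fun c _ => hc c)))

section Congruence

variable (hφ : IsDrinfeldOn q r φ) (hcard : Fintype.card Fq = q) (hq : 3 ≤ q) (hr : 2 ≤ r)
include hφ hq hr

theorem valuation_leading_lt_one {x : E} (ht : v (algebraMap Fq[X] E X) ≤ 1)
    {l : Fq[X]} (hl : l ≠ 0) (hx : φ l x = 0) (hx1 : 1 < v x)
    (hlev : v (algebraMap Fq[X] E X) * v x ^ q ^ (r - 1) = 1) :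
    v (1 + (algebraMap Fq[X] E X * x ^ q ^ (r - 1)) ^ (q - 1)) < 1 := by
  have ht0 : v (algebraMap Fq[X] E X) ≠ 0 := left_ne_zero_of_mul_eq_one hlev
  have hφX : v (φ X x) ≤ v x := by
    have hk : φ l (φ X x) = 0 := by rw [← phi_mul, mul_comm, phi_mul, hx, map_zero]
    have h1 := valuation_mul_pow_le_one v hφ hq hr ht hl hk
    rw [← hlev] at h1
    exact le_of_pow_le_pow_left₀ (n := q ^ (r - 1)) (by positivity) zero_le
      (le_of_mul_le_mul_left h1 (zero_lt_iff.2 ht0))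
  have hlin : v (algebraMap Fq[X] E X * x) ≤ v x := by
    rw [map_mul]; exact mul_le_of_le_one_left' ht
  have hN : v x < v x ^ q ^ (r - 1) := lt_self_pow₀ hx1 (Nat.one_lt_pow (by omega) (by omega))
  have h2 : v (x ^ q ^ (r - 1) * (1 + (algebraMap Fq[X] E X * x ^ q ^ (r - 1)) ^ (q - 1))) ≤
      v x := by
    have h3 := phi_X_eq hφ (by omega) hr x
    rw [← sub_eq_iff_eq_add'] at h3
    rw [← h3]
    exact v.map_sub_le hφX hlin
  by_contra! h
  rw [map_mul, map_pow] at h2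
  exact absurd h2 (not_le.2 (hN.trans_le (le_mul_of_one_le_right zero_le h)))

include hcard

theorem exists_const_valuation_sub_lt {x y : E} (ht : v (algebraMap Fq[X] E X) ≤ 1)
    {l : Fq[X]} (hl : l ≠ 0) (hx : φ l x = 0) (hy : φ l y = 0) (hx1 : 1 < v x)
    (hxy : v x = v y) : ∃ c : Fq, v (y - φ (C c) x) < v x := by
  obtain ⟨m, hm, hmx, hix⟩ := exists_level v hφ hq hr ht hl hx hx1
  have ht0 : v (algebraMap Fq[X] E X) ≠ 0 := left_ne_zero_of_mul_eq_one hmx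
  have hN : 1 < q ^ (r - 1) := Nat.one_lt_pow (by omega) (by omega)
  -- points with the same valuation have the same level
  have hlev : ∀ z, φ l z = 0 → v z = v x →
      v (φ (X ^ (m - 1)) z) = v x ^ (q ^ (r - 1)) ^ (m - 1) := by
    intro z hz hzx
    obtain ⟨m', hm', hmz, hiz⟩ := exists_level v hφ hq hr ht hl hz (hzx ▸ hx1)
    have : v x ^ (q ^ (r - 1)) ^ m' = v x ^ (q ^ (r - 1)) ^ m :=
      mul_left_cancel₀ ht0 (by rw [hmx, ← hzx, hmz])
    have h1 := (pow_right_strictMono₀ hx1).injective this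
    have h2 := Nat.pow_right_injective hN h1
    rw [hiz (m - 1) (by omega), hzx]
  set x' := φ (X ^ (m - 1)) x with hx'
  set y' := φ (X ^ (m - 1)) y with hy'
  have hvx' : v x' = v x ^ (q ^ (r - 1)) ^ (m - 1) := hlev x hx rfl
  have hvy' : v y' = v x ^ (q ^ (r - 1)) ^ (m - 1) := hlev y hy hxy.symm
  have hx'1 : 1 < v x' := by rw [hvx']; exact one_lt_pow₀ hx1 (by positivity)
  have hlx' : v (algebraMap Fq[X] E X) * v x' ^ q ^ (r - 1) = 1 := by
    rw [hvx', ← pow_mul, ← pow_succ, Nat.sub_add_cancel hm, hmx]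
  have hkill : ∀ z, φ l z = 0 → φ l (φ (X ^ (m - 1)) z) = 0 := fun z hz => by
    rw [← phi_mul, mul_comm, phi_mul, hz, map_zero]
  have hA := valuation_leading_lt_one v hφ hq hr ht hl (hkill x hx) hx'1 hlx'
  have hB := valuation_leading_lt_one v hφ hq hr ht hl (hkill y hy)
    (by rw [← hy', hvy', ← hvx']; exact hx'1) (by rw [← hy', hvy', ← hvx']; exact hlx')
  rw [← hx'] at hA
  rw [← hy'] at hB
  have hx'0 : x' ≠ 0 := by
    rintro h
    rw [h, map_zero] at hx'1
    exact not_lt_zero hx'1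
  set u := y' / x' with hu
  have hy'u : y' = x' * u := by rw [hu, mul_div_cancel₀ _ hx'0]
  have hvu : v u = 1 := by
    rw [hu, map_div₀, hvx', hvy', div_self]
    exact pow_ne_zero _ (zero_lt_one.trans hx1).ne'
  set α := (algebraMap Fq[X] E X * x' ^ q ^ (r - 1)) ^ (q - 1) with hα
  have hvα : v α = 1 := by rw [hα, map_pow, map_mul, map_pow, hlx', one_pow]
  have hpow : v (u ^ (q * q ^ (r - 1)) - u ^ q ^ (r - 1)) < 1 := by
    have h1 : (algebraMap Fq[X] E X * y' ^ q ^ (r - 1)) ^ (q - 1) =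
        α * u ^ (q ^ (r - 1) * (q - 1)) := by
      rw [hy'u, hα, pow_mul]; ring
    rw [h1] at hB
    have h2 : α * (u ^ (q * q ^ (r - 1)) - u ^ q ^ (r - 1)) =
        u ^ q ^ (r - 1) * ((1 + α * u ^ (q ^ (r - 1) * (q - 1))) - (1 + α)) := by
      have h3 : q * q ^ (r - 1) = q ^ (r - 1) + q ^ (r - 1) * (q - 1) := by
        obtain ⟨q, rfl⟩ := Nat.exists_eq_add_of_le' (show 1 ≤ q by omega)
        simp only [Nat.add_sub_cancel]
        ring
      rw [h3, pow_add]; ring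
    have h3 := congrArg v h2
    rw [map_mul, hvα, one_mul, map_mul, map_pow, hvu, one_pow, one_mul] at h3
    rw [h3]
    exact v.map_sub_lt hB hA
  obtain ⟨c, hc⟩ := exists_const_valuation_sub_lt_one v hcard hpow
  refine ⟨c, ?_⟩
  have hle : v (y - φ (C c) x) ≤ v x := by
    refine v.map_sub_le hxy.ge ?_
    rw [hφ.1, map_mul]
    exact mul_le_of_le_one_left' (valuation_const_le v c)
  refine lt_of_le_of_ne hle fun heq => ?_
  have h1 := hlev (y - φ (C c) x)
    (by rw [map_sub, hy, ← phi_mul, mul_comm, phi_mul, hx, map_zero, sub_zero]) heq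
  rw [map_sub, ← phi_mul, mul_comm, phi_mul, ← hx', ← hy', ← hvx', hφ.1] at h1
  have h2 : y' - algebraMap Fq[X] E (C c) * x' = x' * (u - algebraMap Fq[X] E (C c)) := by
    rw [hy'u]; ring
  rw [h2, map_mul] at h1
  exact absurd h1 (mul_lt_of_lt_one_right (zero_lt_one.trans hx'1) hc).ne

/-- If torsion points are not all integral at `T`, a minimal nonintegral one generates them modulo
integral ones. -/
theorem exists_generator {l : Fq[X]} (hl : l ≠ 0) (ht : v (algebraMap Fq[X] E X) ≤ 1)
    (hfin : {x : E | φ l x = 0}.Finite) (hex : ∃ x, φ l x = 0 ∧ 1 < v x) :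
    ∃ (x : E) (m : ℕ), φ l x = 0 ∧ 1 < v x ∧ v (algebraMap Fq[X] E X) * v x ^ (q ^ (r - 1)) ^ m = 1 ∧
      ∀ y, φ l y = 0 → ∃ a : Fq[X], a.degree < m ∧ v (y - φ a x) ≤ 1 := by
  have hN : 1 < q ^ (r - 1) := Nat.one_lt_pow (by omega) (by omega)
  have hfin' : {x : E | φ l x = 0 ∧ 1 < v x}.Finite := hfin.subset fun x hx => hx.1
  obtain ⟨x, ⟨hx, hx1⟩, hmin⟩ := Set.exists_min_image _ v hfin' hex
  obtain ⟨m, hm, hmx, hix⟩ := exists_level v hφ hq hr ht hl hx hx1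
  have ht0 : v (algebraMap Fq[X] E X) ≠ 0 := left_ne_zero_of_mul_eq_one hmx
  refine ⟨x, m, hx, hx1, hmx, ?_⟩
  by_contra! hbad
  have hfin'' : {y : E | φ l y = 0 ∧ ∀ a : Fq[X], a.degree < m → 1 < v (y - φ a x)}.Finite :=
    hfin.subset fun x hx => hx.1
  obtain ⟨y, ⟨hy, hya⟩, hymin⟩ := Set.exists_min_image _ v hfin'' hbad
  have hy1 : 1 < v y := by
    have := hya 0 (by rw [degree_zero]; exact WithBot.bot_lt_coe m)
    rwa [phi_zero, sub_zero] at this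
  obtain ⟨m', hm', hmy, -⟩ := exists_level v hφ hq hr ht hl hy hy1
  have hpowxy : v x ^ (q ^ (r - 1)) ^ m = v y ^ (q ^ (r - 1)) ^ m' :=
    mul_left_cancel₀ ht0 (by rw [hmx, hmy])
  have hmm : m' ≤ m := by
    by_contra! h
    have h1 : v x ^ (q ^ (r - 1)) ^ m < v x ^ (q ^ (r - 1)) ^ m' :=
      pow_lt_pow_right₀ hx1 (Nat.pow_lt_pow_right hN h)
    rw [hpowxy] at h1
    exact absurd h1 (not_lt.2 (pow_le_pow_left₀ zero_le (hmin y ⟨hy, hy1⟩) _))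
  have hv : v (φ (X ^ (m - m')) x) = v y := by
    rw [hix _ (by omega)]
    refine (pow_left_inj₀ zero_le zero_le (n := (q ^ (r - 1)) ^ m') (by positivity)).1 ?_
    rw [← pow_mul, ← pow_add, Nat.sub_add_cancel hmm, hpowxy]
  obtain ⟨c, hc⟩ := exists_const_valuation_sub_lt v hφ hcard hq hr ht hl
    (x := φ (X ^ (m - m')) x) (y := y)
    (by rw [← phi_mul, mul_comm, phi_mul, hx, map_zero]) hy (hv ▸ hy1) hv
  rw [hv] at hc
  refine absurd hc (not_lt.2 (hymin _ ⟨?_, fun a ha => ?_⟩))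
  · rw [map_sub, hy, phi_phi_eq_zero (phi_phi_eq_zero hx _), sub_zero]
  · have := hya (C c * X ^ (m - m') + a)
      ((degree_add_le _ _).trans_lt (max_lt ((degree_C_mul_X_pow_le _ _).trans_lt
        (by exact_mod_cast (show m - m' < m by omega))) ha))
    rwa [phi_add, phi_mul, ← sub_sub] at this

omit hcard

theorem natDegree_le_of_generator {l : Fq[X]} (hl : Irreducible l)
    (ht : v (algebraMap Fq[X] E X) ≤ 1) {x : E} {m : ℕ} (hx : φ l x = 0) (hx1 : 1 < v x)
    (hgen : ∀ y, φ l y = 0 → ∃ a : Fq[X], a.degree < m ∧ v (y - φ a x) ≤ 1) :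
    l.natDegree ≤ m := by
  obtain ⟨a, ha, hax⟩ := hgen (φ (X ^ m) x) (by rw [← phi_mul, mul_comm, phi_mul, hx, map_zero])
  rw [← phi_sub] at hax
  set b := X ^ m - a
  have hb : b.degree = m := by
    rw [degree_sub_eq_left_of_degree_lt (by rwa [degree_X_pow]), degree_X_pow]
  have hb0 : b ≠ 0 := by
    rintro h
    rw [h, degree_zero] at hb
    exact absurd hb.symm (WithBot.coe_ne_bot)
  by_cases hdvd : l ∣ b
  · exact (natDegree_le_of_dvd hdvd hb0).trans (natDegree_eq_of_degree_eq_some hb).le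
  · exfalso
    obtain ⟨s, s', hs⟩ := (hl.coprime_iff_not_dvd.2 hdvd)
    have h1 : φ (s' * b) x = x := by
      have := phi_one (φ := φ) x
      rw [← hs, phi_add, phi_mul s, hx, map_zero, zero_add] at this
      exact this
    rw [phi_mul] at h1
    exact absurd hx1 (not_lt.2 (h1 ▸ valuation_phi_le v hφ ht hax s'))

end Congruence

end Valuations

theorem separable_map_phiPoly {Fq : Type} {K : Type*} [Field Fq] [Field K] [Algebra Fq[X] K] {q r : ℕ}
    (hq : (q : Fq) = 0) (hr : 2 ≤ r) (hinj : Function.Injective (algebraMap Fq[X] K)) {l : Fq[X]}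
    (hl : l ≠ 0) : ((phiPoly q r l).map (algebraMap Fq[X] K)).Separable := by
  rw [Polynomial.Separable, derivative_map, derivative_phiPoly hq hr, map_C]
  exact isCoprime_one_right.of_isCoprime_of_dvd_right (isUnit_C.2 (isUnit_iff_ne_zero.2
    ((map_ne_zero_iff _ hinj).2 hl))).dvd

section TorsionValues

variable {Fq : Type} [Field Fq] [Fintype Fq] {E : Type*} [Field E] [Algebra Fq[X] E]
  {Γ₀ : Type*} [LinearOrderedCommGroupWithZero Γ₀] (v : Valuation E Γ₀)
  {q r : ℕ} {φ : Fq[X] →+* AddMonoid.End E}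
  (hφ : IsDrinfeldOn q r φ) (hcard : Fintype.card Fq = q) (hr : 2 ≤ r)
include hφ hcard hr

theorem valuation_eq_one_of_phi_eq_zero (ht : v (algebraMap Fq[X] E X) ≤ 1) {l : Fq[X]}
    (hl : v (algebraMap Fq[X] E l) = 1) {w : E} (hw0 : w ≠ 0) (hw : φ l w = 0) (hw1 : v w ≤ 1) :
    v w = 1 := by
  have hq0 : q ≠ 0 := hcard ▸ Fintype.card_ne_zero
  have hq1 : (q : Fq) = 0 := by rw [← hcard, FiniteField.cast_card_eq_zero]
  refine le_antisymm hw1 ?_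
  have h1 := divX_mul_X_add (phiPoly q r l)
  have h2 := divX_mul_X_add (divX (phiPoly q r l))
  rw [coeff_zero_phiPoly hq0, C_0, add_zero, ← h2, coeff_divX, coeff_one_phiPoly hq1 hr] at h1
  rw [← aeval_phiPoly hφ, ← h1] at hw
  simp only [map_mul, map_add, aeval_X, aeval_C] at hw
  have h3 := (mul_eq_zero.1 hw).resolve_right hw0
  have h4 := congrArg v (eq_neg_of_add_eq_zero_right h3)
  rw [Valuation.map_neg, map_mul, hl] at h4
  rw [h4]
  exact mul_le_of_le_one_left' (valuation_aeval_le v ht hw1 _)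

/-- At places above `l`, all nonzero torsion points which reduce to zero have the same value. -/
theorem exists_pow_eq_of_valuation_lt_one (ht : v (algebraMap Fq[X] E X) = 1) {l : Fq[X]}
    (hlm : l.Monic) (hl : v (algebraMap Fq[X] E l) < 1) (hl0 : v (algebraMap Fq[X] E l) ≠ 0)
    (hunit : ∀ a, ¬ l ∣ a → v (algebraMap Fq[X] E a) = 1) :
    ∃ j, j ≠ 0 ∧ ∀ x : E, x ≠ 0 → φ l x = 0 → v x < 1 → v (algebraMap Fq[X] E l) = v x ^ j := by
  classical
  have hq2 : 2 ≤ q := hcard ▸ Fintype.one_lt_card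
  have hq1 : (q : Fq) = 0 := by rw [← hcard, FiniteField.cast_card_eq_zero]
  have hld : l.natDegree ≠ 0 := by
    intro h
    rw [eq_one_of_monic_natDegree_zero hlm h, map_one, map_one] at hl
    exact lt_irrefl _ hl
  set P := phiPoly q r l with hP
  have hex : ∃ j, 2 ≤ j ∧ ¬ l ∣ P.coeff j := by
    obtain ⟨hd, M, hM⟩ := natDegree_phiPoly_leadingCoeff (r := r) hq2 (by omega) hlm
    refine ⟨P.natDegree, ?_, fun h => ?_⟩
    · rw [hd]
      exact hq2.trans (Nat.le_self_pow (Nat.mul_ne_zero (by omega) hld) q)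
    · rw [coeff_natDegree, hM] at h
      have h1 : v (algebraMap Fq[X] E (X ^ M)) < 1 := by
        obtain ⟨b, hb⟩ := h
        rw [hb, map_mul, map_mul]
        exact mul_lt_one_of_lt_of_le hl (valuation_algebraMap_le v ht.le b)
      rw [map_pow, map_pow, ht, one_pow] at h1
      exact lt_irrefl _ h1
  set j := Nat.find hex with hj
  obtain ⟨hj2, hjl⟩ := Nat.find_spec hex
  rw [← hj] at hj2 hjl
  have hjmin : ∀ i, 2 ≤ i → i < j → l ∣ P.coeff i := fun i hi hij => by
    by_contra h
    exact Nat.find_min hex hij ⟨hi, h⟩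
  refine ⟨j - 1, by omega, fun x hx0 hx hx1 => ?_⟩
  have hvx : v x ≠ 0 := v.ne_zero_iff.2 hx0
  have hvx0 : 0 < v x := zero_lt_iff.2 hvx
  have hcj : v (algebraMap Fq[X] E (P.coeff j) * x ^ j) = v x ^ j := by
    rw [map_mul, hunit _ hjl, one_mul, map_pow]
  have hjn : j ≤ P.natDegree := le_natDegree_of_ne_zero fun h => hjl (h ▸ dvd_zero l)
  suffices h : v (algebraMap Fq[X] E l * x) = v x ^ j by
    rw [map_mul] at h
    refine mul_right_cancel₀ hvx ?_
    rw [h, ← pow_succ, Nat.sub_add_cancel (by omega)]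
  by_contra hne
  rw [← hcj] at hne
  have hsum : ∑ i ∈ Finset.range (P.natDegree + 1), algebraMap Fq[X] E (P.coeff i) * x ^ i = 0 := by
    rw [← hx, ← aeval_phiPoly hφ, aeval_eq_sum_range]
    simp_rw [Algebra.smul_def]
    rfl
  rw [← Finset.add_sum_erase _ _ (Finset.mem_range.2 (show 1 < P.natDegree + 1 by omega)),
    ← Finset.add_sum_erase _ _ (Finset.mem_erase.2
      ⟨show j ≠ 1 by omega, Finset.mem_range.2 (show j < P.natDegree + 1 by omega)⟩),
    hP, coeff_one_phiPoly hq1 hr, ← hP, pow_one, ← add_assoc] at hsum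
  have hmax := v.map_add_of_distinct_val hne
  have hlt : v (∑ i ∈ ((Finset.range (P.natDegree + 1)).erase 1).erase j,
      algebraMap Fq[X] E (P.coeff i) * x ^ i) <
      max (v (algebraMap Fq[X] E l * x)) (v (algebraMap Fq[X] E (P.coeff j) * x ^ j)) := by
    have hlx : 0 < v (algebraMap Fq[X] E l * x) := by
      rw [map_mul]; exact mul_pos (zero_lt_iff.2 hl0) hvx0
    refine v.map_sum_lt (lt_max_of_lt_left hlx).ne' fun i hi => ?_
    simp only [Finset.mem_erase, Finset.mem_range] at hi
    obtain ⟨hij, hi1, -⟩ := hi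
    rcases Nat.eq_zero_or_pos i with rfl | hi0
    · rw [hP, coeff_zero_phiPoly (by omega), map_zero, zero_mul, map_zero]
      exact lt_max_of_lt_left hlx
    rcases lt_or_gt_of_ne hij with h | h
    · refine lt_max_of_lt_left ?_
      obtain ⟨b, hb⟩ := hjmin i (by omega) h
      rw [hb, map_mul, map_mul, map_mul, map_mul, map_pow, mul_assoc]
      refine mul_lt_mul_of_pos_left ?_ (zero_lt_iff.2 hl0)
      exact (mul_le_of_le_one_left' (valuation_algebraMap_le v ht.le b)).trans_lt
        (pow_lt_self_of_lt_one₀ hvx0 hx1 (by omega))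
    · refine lt_max_of_lt_right ?_
      rw [hcj, map_mul, map_pow]
      exact (mul_le_of_le_one_left' (valuation_algebraMap_le v ht.le _)).trans_lt
        (pow_lt_pow_right_of_lt_one₀ hvx0 hx1 h)
  rw [← hmax, ← Valuation.map_neg] at hlt
  rw [eq_neg_of_add_eq_zero_left hsum, v.map_neg] at hlt
  exact lt_irrefl _ hlt

theorem valuation_eq_prod {l : Fq[X]} (ht : v (algebraMap Fq[X] E X) = 1) (hlm : l.Monic)
    (hinj : Function.Injective (algebraMap Fq[X] E))
    (hsplit : ((phiPoly q r l).map (algebraMap Fq[X] E)).Splits) [DecidableEq E] (S : Finset E)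
    (hS : ∀ x, x ∈ S ↔ φ l x = 0) :
    v (algebraMap Fq[X] E l) = ∏ x ∈ S.erase 0, v x := by
  have hq2 : 2 ≤ q := hcard ▸ Fintype.one_lt_card
  have hq1 : (q : Fq) = 0 := by rw [← hcard, FiniteField.cast_card_eq_zero]
  obtain ⟨hd, M, hM⟩ := natDegree_phiPoly_leadingCoeff (r := r) hq2 (by omega) hlm
  set P := (phiPoly q r l).map (algebraMap Fq[X] E) with hP
  have hP0 : P ≠ 0 := by
    rw [hP, Polynomial.map_ne_zero_iff hinj]
    intro h
    rw [h, leadingCoeff_zero] at hM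
    exact pow_ne_zero _ X_ne_zero hM.symm
  have hsep : P.Separable := separable_map_phiPoly hq1 hr hinj hlm.ne_zero
  have hroots : P.roots = S.val := by
    rw [← Multiset.toFinset_val P.roots |>.trans (Multiset.dedup_eq_self.2 (nodup_roots hsep))]
    congr 1
    ext x
    rw [Multiset.mem_toFinset, mem_roots hP0, hS, IsRoot, ← aeval_phiPoly hφ, aeval_def, hP,
      eval_map]
  have h0 : (0 : E) ∈ S := (hS 0).2 (map_zero _)
  have hprod : P = C P.leadingCoeff * (X * ∏ x ∈ S.erase 0, (X - C x)) := by
    conv_lhs => rw [hsplit.eq_prod_roots, hroots]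
    congr 1
    change ∏ x ∈ S, (X - C x) = _
    rw [← Finset.mul_prod_erase _ _ h0, C_0, sub_zero]
  have h1 := congrArg (fun Q => v (coeff Q 1)) hprod
  rw [coeff_C_mul, coeff_X_mul, coeff_zero_eq_eval_zero, eval_prod, hP, coeff_map,
    coeff_one_phiPoly hq1 hr, leadingCoeff_map_of_injective hinj, hM, map_mul, map_pow, map_pow,
    ht, one_pow, one_mul, map_prod] at h1
  simpa using h1

end TorsionValues

section Places

open IsDedekindDomain WithZero

/-- Over every finite place of `𝔽_q(T)` a finite Galois extension has a valuation together with an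
inertia group, whose order is the ramification index. -/
theorem exists_valuation_inertia {Fq : Type} {E : Type*} [Field Fq] [Finite Fq] [Field E]
    [Algebra (RatFunc Fq) E] [Algebra Fq[X] E] [IsScalarTower Fq[X] (RatFunc Fq) E]
    [FiniteDimensional (RatFunc Fq) E] [IsGalois (RatFunc Fq) E] {π : Fq[X]} (hπ : Irreducible π) :
    ∃ (v : Valuation E ℤᵐ⁰) (I : Subgroup (E ≃ₐ[RatFunc Fq] E)),
      (∀ a, ¬ π ∣ a → v (algebraMap Fq[X] E a) = 1) ∧
      v (algebraMap Fq[X] E π) < 1 ∧ v (algebraMap Fq[X] E π) ≠ 0 ∧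
      (∀ (x : E) (k : ℕ), v (algebraMap Fq[X] E π) = v x ^ k → k ∣ Nat.card I) ∧
      ∀ σ ∈ I, ∀ x, v x ≤ 1 → v (σ x - x) < 1 := by
  let B := integralClosure Fq[X] E
  have : IsDedekindDomain B := IsIntegralClosure.isDedekindDomain Fq[X] (RatFunc Fq) E B
  have : Module.Finite Fq[X] B := IsIntegralClosure.finite Fq[X] (RatFunc Fq) E B
  have : IsFractionRing B E :=
    IsIntegralClosure.isFractionRing_of_finite_extension Fq[X] (RatFunc Fq) E B
  have hinj : Function.Injective (algebraMap Fq[X] E) := by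
    rw [IsScalarTower.algebraMap_eq Fq[X] (RatFunc Fq) E]
    exact (algebraMap (RatFunc Fq) E).injective.comp (IsFractionRing.injective _ _)
  have : FaithfulSMul Fq[X] E := (faithfulSMul_iff_algebraMap_injective _ _).2 hinj
  have : Module.IsTorsionFree Fq[X] B := inferInstance
  let : MulSemiringAction Gal(E/(RatFunc Fq)) B :=
    IsIntegralClosure.MulSemiringAction Fq[X] (RatFunc Fq) E B
  have : IsGaloisGroup Gal(E/(RatFunc Fq)) Fq[X] B :=
    IsGaloisGroup.of_isFractionRing _ _ _ (RatFunc Fq) E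
  let p : Ideal Fq[X] := Ideal.span {π}
  have hpp : p.IsPrime := (Ideal.span_singleton_prime hπ.ne_zero).2 hπ.prime
  have hp0 : p ≠ ⊥ := by simpa [p] using hπ.ne_zero
  obtain ⟨P, hPp, hPo⟩ : (p.primesOver B).Nonempty := Set.nonempty_coe_sort.1 inferInstance
  have hP0 : P ≠ ⊥ := Ideal.ne_bot_of_liesOver_of_ne_bot hp0 P
  let vp : HeightOneSpectrum Fq[X] := ⟨p, hpp, hp0⟩
  let w : HeightOneSpectrum B := ⟨P, hPp, hP0⟩
  have : w.asIdeal.LiesOver vp.asIdeal := hPo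
  have : Finite (Fq[X] ⧸ p) := by
    have := (AdjoinRoot.powerBasis hπ.ne_zero).finite
    exact Module.finite_of_finite Fq (M := AdjoinRoot π)
  have hcard : Nat.card (P.inertia Gal(E/(RatFunc Fq))) = p.ramificationIdx' P := by
    rw [Ideal.card_inertia_eq_ramificationIdxIn p P,
      Ideal.ramificationIdxIn_eq_ramificationIdx p P Gal(E/(RatFunc Fq)),
      Ideal.ramificationIdx'_eq_ramificationIdx _ _ hp0]
  have hval (a : Fq[X]) : w.valuation E (algebraMap Fq[X] E a) =
      vp.intValuation a ^ (p.ramificationIdx' P) := by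
    rw [IsScalarTower.algebraMap_apply Fq[X] B E, HeightOneSpectrum.valuation_of_algebraMap,
      ← HeightOneSpectrum.intValuation_liesOver vp w]
  have hvπ : w.valuation E (algebraMap Fq[X] E π) = exp (-(p.ramificationIdx' P : ℤ)) := by
    rw [hval, HeightOneSpectrum.intValuation_singleton vp hπ.ne_zero rfl, ← exp_nsmul]
    simp
  have hlt : w.valuation E (algebraMap Fq[X] E π) < 1 := by
    rw [IsScalarTower.algebraMap_apply Fq[X] B E, HeightOneSpectrum.valuation_lt_one_iff_mem]
    change π ∈ P.under Fq[X]
    rw [← P.over_def p]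
    exact Ideal.mem_span_singleton_self π
  refine ⟨w.valuation E, P.inertia _, fun a ha => ?_, hlt, ?_, fun x k hk => ?_,
    fun σ hσ x hx => ?_⟩
  · rw [IsScalarTower.algebraMap_apply Fq[X] B E, HeightOneSpectrum.valuation_eq_one_iff_notMem]
    intro h
    apply ha
    rw [← Ideal.mem_span_singleton]
    change a ∈ p
    rwa [P.over_def p]
  · rw [hvπ]; exact exp_ne_zero
  · rw [hcard]
    rcases eq_or_ne x 0 with rfl | hx
    · rcases eq_or_ne k 0 with rfl | hk0
      · simp only [pow_zero] at hk
        exact absurd hk hlt.ne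
      · rw [map_zero, zero_pow hk0, hvπ] at hk
        exact absurd hk exp_ne_zero
    · obtain ⟨n, hn⟩ : ∃ n : ℤ, w.valuation E x = exp n :=
        ⟨_, (exp_log ((Valuation.ne_zero_iff _).2 hx)).symm⟩
      rw [hvπ, hn, ← exp_nsmul, exp_inj] at hk
      rw [← Int.natCast_dvd_natCast, ← dvd_neg, hk]
      exact ⟨n, by simp⟩
  · have hB (y : B) : (algebraMap B E (σ • y)) = σ (algebraMap B E y) :=
      algebraMap_galRestrict_apply Fq[X] σ y
    have hB' (y : B) : w.valuation E (σ (algebraMap B E y) - algebraMap B E y) < 1 := by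
      rw [← hB, ← map_sub, HeightOneSpectrum.valuation_lt_one_iff_mem]
      exact hσ y
    obtain ⟨n, d, hd⟩ := w.exists_primeCompl_mul_eq_of_integer x hx
    have hd1 : w.valuation E (algebraMap B E d) = 1 :=
      (HeightOneSpectrum.valuation_eq_one_iff_notMem _).2 d.2
    have hσd : w.valuation E (σ (algebraMap B E d)) = 1 := by
      rw [← hd1]
      exact (Valuation.map_eq_of_sub_lt _ (by rw [hd1]; exact hB' d))
    have key : (σ x - x) * σ (algebraMap B E d) =
        (σ (algebraMap B E n) - algebraMap B E n) -
          x * (σ (algebraMap B E d) - algebraMap B E d) := by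
      rw [← hd, map_mul]; ring
    rw [← mul_one (w.valuation E (σ x - x)), ← hσd, ← map_mul, key, hσd]
    refine Valuation.map_sub_lt _ (hB' n) ?_
    rw [map_mul]
    exact (mul_le_of_le_one_left' hx).trans_lt (hB' d)

/-- A field extension of `𝔽_q(T)` has a valuation at the infinite place. -/
theorem exists_valuation_infinity (Fq : Type) (E : Type*) [Field Fq] [Field E]
    [Algebra (RatFunc Fq) E] [Algebra Fq[X] E] [IsScalarTower Fq[X] (RatFunc Fq) E] :
    ∃ V : ValuationSubring E, 1 < V.valuation (algebraMap Fq[X] E X) := by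
  classical
  let w := RatFunc.inftyValuation Fq
  have hX : w RatFunc.X = exp (1 : ℤ) := RatFunc.inftyValuation.X Fq
  have hX1 : w (RatFunc.X)⁻¹ < 1 := by
    rw [map_inv₀, hX, ← exp_neg, ← exp_zero, exp_lt_exp]; norm_num
  obtain ⟨V, hV, hloc⟩ := IsLocalRing.exists_factor_valuationRing
    ((algebraMap (RatFunc Fq) E).comp w.valuationSubring.subtype)
  refine ⟨V, ?_⟩
  let y : w.valuationSubring := ⟨RatFunc.X⁻¹, hX1.le⟩
  have hy : ¬ IsUnit y := by
    rintro hu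
    obtain ⟨z, hz⟩ := isUnit_iff_exists_inv.1 hu
    have h1 : w RatFunc.X⁻¹ * w z = 1 := by
      rw [← map_mul, ← map_one w]
      exact congrArg (fun u : w.valuationSubring => w u) hz
    have h2 : w z ≤ 1 := z.2
    exact (h1 ▸ ((mul_le_of_le_one_right' h2).trans_lt hX1)).false
  have h2 := mt (hloc.map_nonunit y) hy
  have h3 := (V.valuation_lt_one_iff ⟨_, hV y⟩).1 ((IsLocalRing.mem_maximalIdeal _).2 h2)
  have h4 : V.valuation (algebraMap (RatFunc Fq) E RatFunc.X⁻¹) < 1 := h3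
  rw [map_inv₀, map_inv₀] at h4
  rw [IsScalarTower.algebraMap_apply Fq[X] (RatFunc Fq) E, RatFunc.algebraMap_X]
  have h0 : V.valuation (algebraMap (RatFunc Fq) E RatFunc.X) ≠ 0 := by
    simp [RatFunc.X_ne_zero]
  exact (inv_lt_one₀ (zero_lt_iff.2 h0)).1 h4

end Places

section StableProducts

variable {Fq : Type} [Field Fq] [Fintype Fq] {E : Type*} [Field E] [Algebra Fq[X] E]
  {Γ₀ : Type*} [LinearOrderedCommGroupWithZero Γ₀] (v : Valuation E Γ₀)

theorem one_le_valuation_of_one_lt (ht : 1 < v (algebraMap Fq[X] E X)) {a : Fq[X]} (ha : a ≠ 0) :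
    1 ≤ v (algebraMap Fq[X] E a) := by
  induction h : a.natDegree using Nat.strong_induction_on generalizing a with
  | _ n ih =>
    by_cases hd : a.natDegree = 0
    · rw [eq_C_of_natDegree_eq_zero hd] at ha ⊢
      exact (valuation_const v (by simpa using ha)).ge
    · have h0 : a.divX ≠ 0 := by
        rw [Ne, divX_eq_zero_iff]
        intro h1
        exact hd (by rw [h1, natDegree_C])
      have h1 : 1 ≤ v (algebraMap Fq[X] E a.divX) :=
        ih _ (by rw [natDegree_divX_eq_natDegree_tsub_one]; omega) h0 rfl
      have h2 : 1 < v (algebraMap Fq[X] E (X * a.divX)) := by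
        rw [map_mul, map_mul]
        exact ht.trans_le (le_mul_of_one_le_right' h1)
      have h3 : v (algebraMap Fq[X] E a) = v (algebraMap Fq[X] E (X * a.divX)) := by
        refine Valuation.map_eq_of_sub_lt v ?_
        rw [← map_sub]
        nth_rw 1 [← X_mul_divX_add a]
        rw [add_sub_cancel_left]
        exact (valuation_const_le v _).trans_lt h2
      rw [h3]
      exact h2.le

variable [Algebra (RatFunc Fq) E] [IsScalarTower Fq[X] (RatFunc Fq) E]
  [FiniteDimensional (RatFunc Fq) E] [IsGalois (RatFunc Fq) E]

/-- The product of a Galois-stable set of nonzero torsion points which are integral at `T` is a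
polynomial whose value at infinity is less than one, unless the set is empty. -/
theorem eq_empty_of_stable_of_valuation_le_one {q r : ℕ} {φ : Fq[X] →+* AddMonoid.End E}
    (hφ : IsDrinfeldOn q r φ) (hq : 3 ≤ q) (hr : 2 ≤ r) {l : Fq[X]} (hl : l ≠ 0)
    (v : Valuation E (WithZero (Multiplicative ℤ)))
    (hX : v (algebraMap Fq[X] E X) < 1) (hunit : ∀ a, ¬ X ∣ a → v (algebraMap Fq[X] E a) = 1)
    (S : Finset E) (hS : ∀ x ∈ S, x ≠ 0 ∧ φ l x = 0 ∧ v x ≤ 1)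
    (hstable : ∀ (σ : E ≃ₐ[RatFunc Fq] E), ∀ x ∈ S, σ x ∈ S) : S = ∅ := by
  classical
  have htower (a : Fq[X]) : algebraMap (RatFunc Fq) E (algebraMap Fq[X] (RatFunc Fq) a) =
      algebraMap Fq[X] E a := (IsScalarTower.algebraMap_apply _ _ _ a).symm
  by_contra hne
  obtain ⟨f, hf⟩ : ∏ x ∈ S, x ∈ Set.range (algebraMap (RatFunc Fq) E) := by
    rw [IsGalois.mem_range_algebraMap_iff_fixed]
    intro σ
    have himg : S.image σ = S :=
      Finset.eq_of_subset_of_card_le (Finset.image_subset_iff.2 (hstable σ))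
        (Finset.card_image_of_injective _ σ.injective).ge
    rw [map_prod, ← Finset.prod_image (f := fun x => x) σ.injective.injOn, himg]
  have hp0 : ∏ x ∈ S, x ≠ 0 := Finset.prod_ne_zero_iff.2 fun x hx => (hS x hx).1
  have hmul : (∏ x ∈ S, x) * algebraMap Fq[X] E f.denom = algebraMap Fq[X] E f.num := by
    rw [← hf, ← htower, ← htower, ← map_mul]
    congr 1
    rw [← eq_div_iff ((map_ne_zero_iff _ (IsFractionRing.injective _ _)).2 f.denom_ne_zero)]
    exact (RatFunc.num_div_denom f).symm
  have hden : IsUnit f.denom := by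
    by_contra hu
    obtain ⟨π, hπ, hdvd⟩ := WfDvdMonoid.exists_irreducible_factor hu f.denom_ne_zero
    have hnum : ¬ π ∣ f.num := fun h =>
      hπ.not_isUnit ((RatFunc.isCoprime_num_denom f).isUnit_of_dvd' h hdvd)
    have key (w : Valuation E (WithZero (Multiplicative ℤ)))
        (h1 : ∀ a, ¬ π ∣ a → w (algebraMap Fq[X] E a) = 1) (h2 : w (algebraMap Fq[X] E π) < 1)
        (hX : w (algebraMap Fq[X] E X) ≤ 1) (h3 : ∀ x ∈ S, w x ≤ 1) : False := by
      have h4 : w (∏ x ∈ S, x) ≤ 1 := by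
        rw [map_prod]
        exact Finset.prod_le_one' h3
      have h5 : w (algebraMap Fq[X] E f.denom) < 1 := by
        obtain ⟨b, hb⟩ := hdvd
        rw [hb, map_mul, map_mul]
        exact (mul_le_of_le_one_right' (valuation_algebraMap_le w hX b)).trans_lt h2
      have h6 := congrArg w hmul
      rw [h1 _ hnum, map_mul] at h6
      exact (h6 ▸ (mul_le_of_le_one_left' h4).trans_lt h5).false
    by_cases hπX : π ∣ X
    · have hass := hπ.associated_of_dvd irreducible_X hπX
      refine key v (fun a ha => hunit a fun h => ha (hπX.trans h)) ?_ hX.le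
        fun x hx => (hS x hx).2.2
      obtain ⟨b, hb⟩ := hass.symm.dvd
      rw [hb, map_mul, map_mul]
      exact (mul_le_of_le_one_right' (valuation_algebraMap_le v hX.le b)).trans_lt hX
    · obtain ⟨w, -, h1, h2, -⟩ := exists_valuation_inertia (E := E) hπ
      have hX1 := h1 X hπX
      exact key w h1 h2 hX1.le
        fun x hx => valuation_le_one_of_phi_eq_zero w hφ hq hr hX1 hl (hS x hx).2.1
  obtain ⟨V, hV⟩ := exists_valuation_infinity Fq E
  obtain ⟨x₀, hx₀⟩ := Finset.nonempty_iff_ne_empty.2 hne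
  have hlt (x) (hx : x ∈ S) : V.valuation x < 1 :=
    valuation_lt_one_of_phi_eq_zero V.valuation hφ hq hr hV hl (hS x hx).2.1
  have hprod : V.valuation (∏ x ∈ S, x) < 1 := by
    rw [map_prod, ← Finset.mul_prod_erase _ _ hx₀]
    exact (mul_le_of_le_one_right' (Finset.prod_le_one' fun x hx =>
      (hlt x (Finset.mem_of_mem_erase hx)).le)).trans_lt (hlt x₀ hx₀)
  obtain ⟨c, hc, hcd⟩ := isUnit_iff.1 hden
  rw [← hcd] at hmul
  have h1 := congrArg V.valuation hmul
  rw [map_mul, valuation_const _ hc.ne_zero, mul_one] at h1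
  refine (one_le_valuation_of_one_lt V.valuation hV (a := f.num) ?_).not_gt (h1 ▸ hprod)
  rintro h0
  rw [h0, map_zero] at hmul
  exact mul_ne_zero hp0 (by
    rw [← htower]
    exact (_root_.map_ne_zero _).2 ((map_ne_zero_iff _ (IsFractionRing.injective _ _)).2
      (by simpa using hc.ne_zero))) hmul

end StableProducts

/-- A vector space over `K = 𝔽_𝔩` together with an identification with the `𝔩`-torsion of `φ`
inside the splitting field `E`, and the Galois representation on it. -/
structure TorsionModel {Fq : Type} {E : Type*} [Field Fq] [Field E] [Algebra Fq[X] E]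
    [Algebra (RatFunc Fq) E] (φ : Fq[X] →+* AddMonoid.End E) (l : Fq[X]) (K V : Type*)
    [Field K] [AddCommGroup V] [Module K V] where
  red : Fq[X] →+* K
  red_surjective : Function.Surjective red
  red_eq_zero_iff : ∀ a, red a = 0 ↔ l ∣ a
  emb : V →+ E
  emb_injective : Function.Injective emb
  mem_range_iff : ∀ x, φ l x = 0 ↔ ∃ y, emb y = x
  emb_smul : ∀ a y, emb (red a • y) = φ a (emb y)
  rep : (E ≃ₐ[RatFunc Fq] E) →* (V ≃ₗ[K] V)
  emb_rep : ∀ σ y, emb (rep σ y) = σ (emb y)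
  rep_injective : Function.Injective rep

namespace TorsionModel

variable {Fq : Type} {E : Type*} [Field Fq] [Field E] [Algebra Fq[X] E]
    [Algebra (RatFunc Fq) E] {φ : Fq[X] →+* AddMonoid.End E} {l : Fq[X]} {K V : Type*}
    [Field K] [AddCommGroup V] [Module K V] (D : TorsionModel φ l K V)

include D

theorem phi_emb (y : V) : φ l (D.emb y) = 0 := (D.mem_range_iff _).2 ⟨y, rfl⟩

theorem finite_galoisGroup [Finite V] : Finite (E ≃ₐ[RatFunc Fq] E) :=
  have := DFunLike.finite (V ≃ₗ[K] V)
  Finite.of_injective D.rep D.rep_injective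

theorem emb_eq_zero {y : V} : D.emb y = 0 ↔ y = 0 := map_eq_zero_iff _ D.emb_injective

variable [Fintype Fq] {q r : ℕ} (hφ : IsDrinfeldOn q r φ)
include hφ

section Filtration

variable {Γ₀ : Type*} [LinearOrderedCommGroupWithZero Γ₀] (v : Valuation E Γ₀)

/-- The torsion points which are integral for `v`. -/
def integralPoints (ht : v (algebraMap Fq[X] E X) ≤ 1) : Submodule K V where
  carrier := {y | v (D.emb y) ≤ 1}
  zero_mem' := by simp
  add_mem' {a b} ha hb := by
    simp only [Set.mem_ofPred_eq, map_add] at *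
    exact v.map_add_le ha hb
  smul_mem' c y hy := by
    obtain ⟨a, rfl⟩ := D.red_surjective c
    simp only [Set.mem_ofPred_eq, D.emb_smul] at *
    exact valuation_phi_le v hφ ht hy a

theorem mem_integralPoints (ht : v (algebraMap Fq[X] E X) ≤ 1) {y : V} :
    y ∈ D.integralPoints hφ v ht ↔ v (D.emb y) ≤ 1 := Iff.rfl

end Filtration

variable [Finite V] [Finite K] (hcard : Fintype.card Fq = q) (hq : 3 ≤ q) (hr : 2 ≤ r)
  (hl : Irreducible l)

include hq hr hl

theorem stable_eq_bot [IsScalarTower Fq[X] (RatFunc Fq) E] [FiniteDimensional (RatFunc Fq) E]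
    [IsGalois (RatFunc Fq) E] (v : Valuation E (WithZero (Multiplicative ℤ)))
    (hX : v (algebraMap Fq[X] E X) < 1) (hunit : ∀ a, ¬ X ∣ a → v (algebraMap Fq[X] E a) = 1)
    (M : Submodule K V) (hM : ∀ σ, ∀ y ∈ M, D.rep σ y ∈ M) (hMv : ∀ y ∈ M, v (D.emb y) ≤ 1) :
    M = ⊥ := by
  classical
  have hfin : {x | ∃ y ∈ M, y ≠ 0 ∧ D.emb y = x}.Finite :=
    (Set.finite_range D.emb).subset (by rintro _ ⟨y, -, -, rfl⟩; exact ⟨y, rfl⟩)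
  have h := eq_empty_of_stable_of_valuation_le_one hφ hq hr hl.ne_zero v hX hunit hfin.toFinset
    (by
      intro x hx
      obtain ⟨y, hy, hy0, rfl⟩ := hfin.mem_toFinset.1 hx
      exact ⟨D.emb_eq_zero.not.2 hy0, D.phi_emb y, hMv y hy⟩)
    (by
      intro σ x hx
      obtain ⟨y, hy, hy0, rfl⟩ := hfin.mem_toFinset.1 hx
      exact hfin.mem_toFinset.2 ⟨D.rep σ y, hM σ y hy, by simpa using hy0, D.emb_rep σ y⟩)
  rw [Submodule.eq_bot_iff]
  intro y hy
  by_contra hy0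
  have : D.emb y ∈ hfin.toFinset := hfin.mem_toFinset.2 ⟨y, hy, hy0, rfl⟩
  simp [h] at this

include hcard

/-- The inertia group at `T` contains all transvections along the hyperplane of integral torsion
points. -/
theorem exists_transvections {v : Valuation E (WithZero (Multiplicative ℤ))}
    {I : Subgroup (E ≃ₐ[RatFunc Fq] E)}
    (hcV : Nat.card V ≤ q ^ (r * l.natDegree)) (hcK : Nat.card K = q ^ l.natDegree)
    (hX : v (algebraMap Fq[X] E X) < 1) (hl1 : v (algebraMap Fq[X] E l) = 1)
    (hI : ∀ (x : E) (k : ℕ), v (algebraMap Fq[X] E X) = v x ^ k → k ∣ Nat.card I)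
    (hinert : ∀ σ ∈ I, ∀ x, v x ≤ 1 → v (σ x - x) < 1)
    (hex : ∃ y, 1 < v (D.emb y)) :
    ∃ f : Module.Dual K V, (∀ y, f y = 0 ↔ v (D.emb y) ≤ 1) ∧
      ∀ (w : V) (h : f w = 0), LinearEquiv.transvection h ∈ D.rep.range := by
  classical
  have := D.finite_galoisGroup
  obtain ⟨_, m, hx, hx1, hxm, hgen⟩ := exists_generator v hφ hcard hq hr hl.ne_zero hX.le
    ((Set.finite_range D.emb).subset fun x hx => (D.mem_range_iff x).1 hx)
    (by obtain ⟨y, hy⟩ := hex; exact ⟨_, D.phi_emb y, hy⟩)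
  obtain ⟨x₁, rfl⟩ := (D.mem_range_iff _).1 hx
  have hdm := natDegree_le_of_generator v hφ hq hr hl hX.le hx hx1 hgen
  set N := q ^ (r - 1) with hN
  let W := D.integralPoints hφ v hX.le
  have hdecomp (y : V) : ∃ w ∈ W, ∃ c : K, y = w + c • x₁ := by
    obtain ⟨a, -, ha⟩ := hgen _ (D.phi_emb y)
    refine ⟨y - D.red a • x₁, ?_, D.red a, by simp⟩
    rw [D.mem_integralPoints hφ v hX.le, map_sub, D.emb_smul]
    exact ha
  have hx₁ : x₁ ∉ W := fun h => h.not_gt hx1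
  obtain ⟨f, hf1, hWf⟩ := Submodule.exists_le_ker_of_notMem hx₁
  have hfW (y : V) : f y = 0 ↔ y ∈ W := by
    refine ⟨fun h => ?_, fun h => hWf h⟩
    obtain ⟨w, hw, c, rfl⟩ := hdecomp y
    rw [map_add, LinearMap.mem_ker.1 (hWf hw), zero_add, map_smul, smul_eq_mul, mul_eq_zero,
      or_iff_left hf1] at h
    simpa [h] using hw
  refine ⟨f, hfW, ?_⟩
  have hfix {σ} (hσ : σ ∈ I) {w : V} (hw : w ∈ W) : D.rep σ w = w := by
    have h1 : v (D.emb (D.rep σ w - w)) < 1 := by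
      rw [map_sub, D.emb_rep]; exact hinert σ hσ _ hw
    by_contra hne
    exact h1.ne (valuation_eq_one_of_phi_eq_zero v hφ hcard hr hX.le hl1
      (D.emb_eq_zero.not.2 (sub_ne_zero.2 hne)) (D.phi_emb _) h1.le)
  let χ₀ (σ : I) : K := f (D.rep σ x₁) / f x₁
  have hχ (σ : I) (y : V) : f (D.rep σ y) = χ₀ σ * f y := by
    obtain ⟨w, hw, c, rfl⟩ := hdecomp y
    simp only [map_add, map_smul, hfix σ.2 hw, (hfW w).2 hw, smul_eq_mul, χ₀]
    field_simp
    ring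
  let χ : I →* K :=
    { toFun := χ₀
      map_one' := by simp [χ₀, hf1]
      map_mul' := fun σ τ => by
        have : f (D.rep (σ * τ) x₁) = χ₀ σ * (χ₀ τ * f x₁) := by
          rw [map_mul, LinearEquiv.mul_apply, hχ, hχ]
        simp only [χ₀] at this ⊢
        rw [Subgroup.coe_mul, this]
        field_simp }
  have hkerW (σ : χ.toHomUnits.ker) : D.rep σ x₁ - x₁ ∈ W := by
    have h1 : χ₀ σ = 1 := congrArg Units.val (MonoidHom.mem_ker.1 σ.2)
    rw [← hfW, map_sub, hχ σ.1, h1, one_mul, sub_self]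
  let g (σ : χ.toHomUnits.ker) : W := ⟨D.rep σ x₁ - x₁, hkerW σ⟩
  have hg : Function.Injective g := by
    intro σ τ h
    have h1 : D.rep σ x₁ = D.rep τ x₁ := sub_left_injective (congrArg Subtype.val h)
    apply Subtype.ext
    apply Subtype.ext
    apply D.rep_injective
    ext y
    obtain ⟨w, hw, c, rfl⟩ := hdecomp y
    rw [map_add, map_add, hfix σ.1.2 hw, hfix τ.1.2 hw, map_smul, map_smul, h1]
  have hq0 : 0 < q := by omega
  have hdvd : N ^ l.natDegree ∣ Nat.card χ.toHomUnits.ker := by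
    have h1 : N ^ l.natDegree ∣ Nat.card I := by
      refine (pow_dvd_pow N hdm).trans (hI (D.emb x₁)⁻¹ _ ?_)
      rw [map_inv₀, inv_pow]
      exact eq_inv_of_mul_eq_one_left hxm
    rw [← Subgroup.card_mul_index χ.toHomUnits.ker, Subgroup.index_ker] at h1
    refine Nat.Coprime.dvd_of_dvd_mul_right ?_ h1
    refine Nat.Coprime.coprime_dvd_right (Subgroup.card_subgroup_dvd_card _) ?_
    rw [Nat.card_units, hcK]
    refine Nat.Coprime.pow_left _ (Nat.Coprime.pow_left _ ?_)
    have h2 : 1 ≤ q ^ l.natDegree := Nat.one_le_pow _ _ hq0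
    exact Nat.Coprime.coprime_dvd_left (dvd_pow_self q hl.natDegree_pos.ne')
      ((Nat.coprime_self_sub_right h2).2 (Nat.coprime_one_right _))
  have hcW : Nat.card W * Nat.card K = Nat.card V := by
    rw [← Nat.card_prod]
    refine Nat.card_eq_of_bijective (fun z : W × K => (z.1 : V) + z.2 • x₁)
      ⟨fun z z' h => ?_, fun y => ?_⟩
    · have h1 := congrArg f h
      simp only [map_add, map_smul, (hfW _).2 z.1.2, (hfW _).2 z'.1.2, zero_add, smul_eq_mul] at h1
      have h2 := mul_right_cancel₀ hf1 h1
      simp only [h2, add_left_inj, SetLike.coe_eq_coe] at h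
      exact Prod.ext h h2
    · obtain ⟨w, hw, c, rfl⟩ := hdecomp y
      exact ⟨(⟨w, hw⟩, c), rfl⟩
  have hle : Nat.card W ≤ Nat.card χ.toHomUnits.ker := by
    refine le_trans ?_ (Nat.le_of_dvd Nat.card_pos hdvd)
    refine Nat.le_of_mul_le_mul_right ?_ (Nat.pow_pos hq0 : 0 < q ^ l.natDegree)
    rw [← hcK, hcW, hcK, hN, ← pow_mul, ← pow_add]
    refine hcV.trans_eq ?_
    congr 1
    obtain ⟨s, rfl⟩ : ∃ s, r = s + 1 := ⟨r - 1, by omega⟩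
    rw [Nat.add_sub_cancel]; ring
  have hsurj : Function.Surjective g :=
    (hg.bijective_of_nat_card_le hle).surjective
  intro w hw
  obtain ⟨σ, hσ⟩ := hsurj ⟨f x₁ • w, W.smul_mem _ ((hfW w).1 hw)⟩
  have hσ' : D.rep σ x₁ = x₁ + f x₁ • w := by
    rw [← sub_eq_iff_eq_add']
    exact congrArg Subtype.val hσ
  refine ⟨σ, ?_⟩
  ext y
  obtain ⟨u, hu, c, rfl⟩ := hdecomp y
  rw [LinearEquiv.transvection.apply]
  simp only [map_add, map_smul, hfix σ.1.2 hu, hσ', (hfW u).2 hu, zero_add, smul_eq_mul, smul_add,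
    smul_smul, add_assoc]

end TorsionModel

theorem valuation_phi_lt {Fq : Type} {E : Type*} [Field Fq] [Fintype Fq] [Field E]
    [Algebra Fq[X] E] {φ : Fq[X] →+* AddMonoid.End E} {Γ₀ : Type*}
    [LinearOrderedCommGroupWithZero Γ₀] (v : Valuation E Γ₀) {q r : ℕ} (hφ : IsDrinfeldOn q r φ)
    (hq : q ≠ 0) (ht : v (algebraMap Fq[X] E X) ≤ 1) {x : E} (hx : v x < 1) (a : Fq[X]) :
    v (φ a x) < 1 := by
  have h : phiPoly q r a = X * (phiPoly q r a).divX := by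
    conv_lhs => rw [← X_mul_divX_add (phiPoly q r a), coeff_zero_phiPoly hq, map_zero, add_zero]
  rw [← aeval_phiPoly hφ, h, map_mul, aeval_X, map_mul]
  exact (mul_le_of_le_one_right' (valuation_aeval_le v ht hx.le _)).trans_lt hx

namespace TorsionModel

section Determinant

variable {Fq : Type} {E : Type*} [Field Fq] [Fintype Fq] [Field E] [Algebra Fq[X] E]
    [Algebra (RatFunc Fq) E] {φ : Fq[X] →+* AddMonoid.End E} {l : Fq[X]} {K V : Type*}
    [Field K] [AddCommGroup V] [Module K V] (D : TorsionModel φ l K V)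
    {Γ₀ : Type*} [LinearOrderedCommGroupWithZero Γ₀] {v : Valuation E Γ₀}
    {I : Subgroup (E ≃ₐ[RatFunc Fq] E)} {q r : ℕ}
include D

/-- The torsion points which reduce to zero for `v`. -/
def kernelOfReduction (hφ : IsDrinfeldOn q r φ) (hq : q ≠ 0) (v : Valuation E Γ₀)
    (ht : v (algebraMap Fq[X] E X) ≤ 1) : Submodule K V where
  carrier := {y | v (D.emb y) < 1}
  zero_mem' := by simp
  add_mem' {a b} ha hb := by
    simp only [Set.mem_ofPred_eq, map_add] at *
    exact v.map_add_lt ha hb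
  smul_mem' c y hy := by
    obtain ⟨a, rfl⟩ := D.red_surjective c
    simp only [Set.mem_ofPred_eq, D.emb_smul] at *
    exact valuation_phi_lt v hφ hq ht hy a

/-- Inertia acts on ratios of torsion points of equal value trivially modulo the maximal ideal. -/
theorem emb_rep_mul_sub_lt {κ : Γ₀} (hκ : κ ≠ 0) (hinert : ∀ σ ∈ I, ∀ x, v x ≤ 1 → v (σ x - x) < 1)
    {σ : E ≃ₐ[RatFunc Fq] E} (hσ : σ ∈ I) {x y : V} (hx : v (D.emb x) = κ) (hy : v (D.emb y) = κ)
    (hσy : v (D.emb (D.rep σ y)) = κ) :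
    v (D.emb (D.rep σ x) * D.emb y - D.emb x * D.emb (D.rep σ y)) < κ ^ 2 := by
  have hy0 : D.emb y ≠ 0 := (v.ne_zero_iff).1 (hy ▸ hκ)
  have hσy0 : D.emb (D.rep σ y) ≠ 0 := (v.ne_zero_iff).1 (hσy ▸ hκ)
  have h1 : v (D.emb x / D.emb y) ≤ 1 := by rw [map_div₀, hx, hy, div_self hκ]
  have h2 := hinert σ hσ _ h1
  rw [map_div₀, ← D.emb_rep, ← D.emb_rep] at h2
  have h3 : D.emb (D.rep σ x) * D.emb y - D.emb x * D.emb (D.rep σ y) =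
      (D.emb (D.rep σ x) / D.emb (D.rep σ y) - D.emb x / D.emb y) *
        (D.emb y * D.emb (D.rep σ y)) := by
    field_simp
  rw [h3, map_mul, map_mul, hy, hσy, ← sq]
  have h4 : 0 < κ ^ 2 := zero_lt_iff.2 (pow_ne_zero 2 hκ)
  exact (mul_lt_mul_of_pos_right h2 h4).trans_eq (one_mul _)

variable [Finite V] [Finite K]

/-- If the order of inertia is divisible by the number of nonzero points of a stable subspace `U`
on which the valuation is constant, and inertia acts trivially on the quotient, then all
determinants occur. -/
theorem exists_det_eq (hcard : Fintype.card Fq = q) (hcK : Nat.card K = q ^ l.natDegree)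
    (hl : l.natDegree ≠ 0)
    (U : Submodule K V) (hU : U ≠ ⊥) {κ : Γ₀} (hκ : κ ≠ 0)
    (hval : ∀ y ∈ U, y ≠ 0 → v (D.emb y) = κ)
    (hinert : ∀ σ ∈ I, ∀ x, v x ≤ 1 → v (σ x - x) < 1)
    (hsub : ∀ σ ∈ I, ∀ y, D.rep σ y - y ∈ U) (hdvd : Nat.card U - 1 ∣ Nat.card I) (a : Kˣ) :
    ∃ g ∈ D.rep.range, LinearEquiv.det g = a := by
  classical
  have := D.finite_galoisGroup
  obtain ⟨x₀, hx₀U, hx₀⟩ := (Submodule.ne_bot_iff U).1 hU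
  have hstable {σ} (hσ : σ ∈ I) : ∀ y ∈ U, (D.rep σ : V →ₗ[K] V) y ∈ U := fun y hy => by
    have := U.add_mem (hsub σ hσ y) hy
    rwa [sub_add_cancel] at this
  have hzero {y : V} (hy : y ∈ U) (h : v (D.emb y * D.emb x₀) < κ ^ 2) : y = 0 := by
    by_contra h0
    rw [map_mul, hval y hy h0, hval x₀ hx₀U hx₀, ← sq] at h
    exact h.false
  have hlt {σ} (hσ : σ ∈ I) {x y : V} (hx : x ∈ U) (hy : y ∈ U) (hx0 : x ≠ 0) (hy0 : y ≠ 0) :=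
    D.emb_rep_mul_sub_lt hκ hinert hσ (hval x hx hx0) (hval y hy hy0)
      (hval _ (hstable hσ y hy) (by simpa using hy0))
  have hfree {σ τ} (hσ : σ ∈ I) (hτ : τ ∈ I) (h : D.rep σ x₀ = D.rep τ x₀) {y : V} (hy : y ∈ U) :
      D.rep σ y = D.rep τ y := by
    rcases eq_or_ne y 0 with rfl | hy0
    · simp
    refine sub_eq_zero.1 (hzero (U.sub_mem (hstable hσ y hy) (hstable hτ y hy)) ?_)
    have h1 := v.map_sub_lt (hlt hσ hy hx₀U hy0 hx₀) (hlt hτ hy hx₀U hy0 hx₀)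
    rw [h, sub_sub_sub_cancel_right, ← sub_mul, ← map_sub] at h1
    exact h1
  have hcomm {σ τ} (hσ : σ ∈ I) (hτ : τ ∈ I) {y : V} (hy : y ∈ U) :
      D.rep (σ * τ) y = D.rep (τ * σ) y := by
    refine hfree (I.mul_mem hσ hτ) (I.mul_mem hτ hσ) ?_ hy
    have hσx := hstable hσ x₀ hx₀U
    have hτx := hstable hτ x₀ hx₀U
    have h1 := v.map_sub_lt (hlt hσ hτx hx₀U (by simpa using hx₀) hx₀)
      (hlt hτ hσx hx₀U (by simpa using hx₀) hx₀)
    refine sub_eq_zero.1 (hzero (U.sub_mem (hstable (I.mul_mem hσ hτ) _ hx₀U)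
      (hstable (I.mul_mem hτ hσ) _ hx₀U)) ?_)
    rw [(by rw [map_mul]; rfl : D.rep (σ * τ) x₀ = D.rep σ (D.rep τ x₀)),
      (by rw [map_mul]; rfl : D.rep (τ * σ) x₀ = D.rep τ (D.rep σ x₀)), map_sub, sub_mul]
    refine lt_of_eq_of_lt (congrArg v ?_) h1
    simp only [LinearEquiv.coe_coe]
    ring
  let ψ : I →* Module.End K U :=
    { toFun := fun σ => (D.rep σ : V →ₗ[K] V).restrict (hstable σ.2)
      map_one' := by ext; simp
      map_mul' := fun σ τ => by ext; simp }
  have hψ (σ : I) (y : U) : (ψ σ y : V) = D.rep σ y := rfl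
  have hq0 : 0 < q := hcard ▸ Fintype.card_pos
  have hqV (y : V) : q • y = 0 := by
    have h1 : (q : K) = 0 := by
      rw [← map_natCast D.red, ← map_natCast C, ← hcard, FiniteField.cast_card_eq_zero, map_zero,
        map_zero]
    rw [← Nat.cast_smul_eq_nsmul K, h1, zero_smul]
  have hcop : (Nat.card U - 1).Coprime (Nat.card ψ.toHomUnits.ker) := by
    refine Nat.Coprime.symm (Nat.coprime_of_dvd fun s hs h1 h2 => ?_)
    have : Fact s.Prime := ⟨hs⟩
    obtain ⟨σ, hσ⟩ := exists_prime_orderOf_dvd_card' s h1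
    have htriv {y : V} (hy : y ∈ U) : D.rep σ y = y := by
      have h3 : ψ σ = 1 := congrArg Units.val (MonoidHom.mem_ker.1 σ.2)
      have := congrArg (fun f : Module.End K U => (f ⟨y, hy⟩ : V)) h3
      exact this
    have hpow (n : ℕ) (y : V) : D.rep ((σ : I) ^ n : I) y = y + n • (D.rep σ y - y) := by
      induction n with
      | zero => simp
      | succ n ih =>
        rw [pow_succ', Subgroup.coe_mul, map_mul, LinearEquiv.mul_apply, ih, map_add, map_nsmul,
          htriv (hsub σ σ.1.2 y), succ_nsmul]
        abel
    have h3 : σ ^ q = 1 := by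
      apply Subtype.ext
      apply Subtype.ext
      apply D.rep_injective
      ext y
      have := hpow q y
      rw [hqV, add_zero] at this
      simpa using this
    have h4 : s ∣ q := hσ ▸ orderOf_dvd_of_pow_eq_one h3
    have h5 : s ∣ Nat.card U := by
      have : Nontrivial U := (Submodule.nontrivial_iff_ne_bot).2 hU
      rw [Module.natCard_eq_pow_finrank (K := K), hcK]
      exact h4.trans ((dvd_pow_self q hl).trans (dvd_pow_self _ Module.finrank_pos.ne'))
    have h6 : 1 ≤ Nat.card U := Nat.card_pos
    exact hs.one_lt.ne' (Nat.dvd_one.1 (by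
      have := (Nat.dvd_sub h5 h2); rwa [Nat.sub_sub_self h6] at this))
  have hdvd' : Nat.card U - 1 ∣ Nat.card ψ.toHomUnits.range := by
    rw [← Subgroup.card_mul_index ψ.toHomUnits.ker, Subgroup.index_ker] at hdvd
    exact hcop.dvd_of_dvd_mul_left hdvd
  let orb (c : ψ.toHomUnits.range) : {y : U // y ≠ 0} :=
    ⟨(c : (Module.End K U)ˣ).val ⟨x₀, hx₀U⟩, by
      obtain ⟨_, σ, rfl⟩ := c
      intro h
      have h1 : D.rep σ x₀ = 0 := congrArg Subtype.val h
      exact hx₀ (by simpa using h1)⟩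
  have horb : Function.Injective orb := by
    rintro ⟨_, σ, rfl⟩ ⟨_, τ, rfl⟩ h
    have h1 : D.rep σ x₀ = D.rep τ x₀ := congrArg (fun z => (z.1 : V)) h
    apply Subtype.ext
    apply Units.ext
    ext y
    exact hfree σ.2 τ.2 h1 y.2
  have hsurj : Function.Surjective orb := by
    refine (horb.bijective_of_nat_card_le ?_).surjective
    have h1 : Nat.card {y : U // y ≠ 0} = Nat.card U - 1 := by
      have := Fintype.ofFinite U
      rw [Nat.card_eq_fintype_card, Nat.card_eq_fintype_card, Fintype.card_subtype_compl,
        Fintype.card_subtype_eq]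
    have : Finite ψ.toHomUnits.range :=
      Finite.of_surjective _ ψ.toHomUnits.rangeRestrict_surjective
    rw [h1]
    exact Nat.le_of_dvd Nat.card_pos hdvd'
  obtain ⟨_, ⟨σ, rfl⟩, hσ⟩ := exists_det_eq_of_commute_of_transitive (Set.range ψ)
    (by
      rintro _ ⟨σ, rfl⟩ _ ⟨τ, rfl⟩
      ext y
      have h := hcomm σ.2 τ.2 y.2
      rw [map_mul, map_mul] at h
      exact h)
    (by
      rintro _ ⟨σ, rfl⟩ y z h
      exact Subtype.ext ((D.rep σ).injective (congrArg Subtype.val h)))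
    (x₀ := ⟨x₀, hx₀U⟩) (by simpa using hx₀)
    (by
      intro y hy
      obtain ⟨⟨_, σ, rfl⟩, h⟩ := hsurj ⟨y, hy⟩
      exact ⟨ψ σ, ⟨σ, rfl⟩, congrArg Subtype.val h⟩) a.ne_zero
  refine ⟨D.rep σ, ⟨σ, rfl⟩, ?_⟩
  ext
  rw [LinearEquiv.coe_det, LinearMap.det_eq_det_mul_det U _ (hstable σ.2)]
  have h1 : U.mapQ U (D.rep σ : V →ₗ[K] V) (hstable σ.2) = LinearMap.id := by
    ext y
    simp only [LinearMap.comp_apply, Submodule.mkQ_apply, Submodule.mapQ_apply, LinearMap.id_apply]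
    exact (Submodule.Quotient.eq U).2 (hsub σ σ.2 y)
  rw [h1, LinearMap.det_id, mul_one]
  exact hσ

end Determinant
end TorsionModel

namespace TorsionModel

section Surjective

variable {Fq : Type} {E : Type*} [Field Fq] [Fintype Fq] [Field E] [Algebra Fq[X] E]
    [Algebra (RatFunc Fq) E] {φ : Fq[X] →+* AddMonoid.End E} {l : Fq[X]} {K V : Type*}
    [Field K] [AddCommGroup V] [Module K V] (D : TorsionModel φ l K V) [Finite V] [Finite K]
    {q r : ℕ} (hφ : IsDrinfeldOn q r φ) (hcard : Fintype.card Fq = q) (hr : 2 ≤ r)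
    (hlm : l.Monic) (hcK : Nat.card K = q ^ l.natDegree)
    (hsplit : ((phiPoly q r l).map (algebraMap Fq[X] E)).Splits)
include D hφ hcard hr hlm hcK hsplit

/-- The image of inertia at `𝔩` has full determinant. -/
theorem exists_det_eq_of_valuation {v : Valuation E (WithZero (Multiplicative ℤ))}
    {I : Subgroup (E ≃ₐ[RatFunc Fq] E)} (hl : Irreducible l)
    (hinj : Function.Injective (algebraMap Fq[X] E))
    (hX : v (algebraMap Fq[X] E X) = 1) (hunit : ∀ a, ¬ l ∣ a → v (algebraMap Fq[X] E a) = 1)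
    (hl1 : v (algebraMap Fq[X] E l) < 1) (hl0 : v (algebraMap Fq[X] E l) ≠ 0)
    (hI : ∀ (x : E) (k : ℕ), v (algebraMap Fq[X] E l) = v x ^ k → k ∣ Nat.card I)
    (hinert : ∀ σ ∈ I, ∀ x, v x ≤ 1 → v (σ x - x) < 1) (hint : ∀ y, v (D.emb y) ≤ 1) (a : Kˣ) :
    ∃ g ∈ D.rep.range, LinearEquiv.det g = a := by
  classical
  have hq0 : q ≠ 0 := hcard ▸ Fintype.card_ne_zero
  have := Fintype.ofFinite V
  let U := D.kernelOfReduction hφ hq0 v hX.le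
  have hUmem (y : V) : y ∈ U ↔ v (D.emb y) < 1 := Iff.rfl
  let S : Finset E := Finset.univ.map ⟨D.emb, D.emb_injective⟩
  have hprod := valuation_eq_prod v hφ hcard hr hX hlm hinj hsplit S
    (fun x => by rw [D.mem_range_iff]; simp [S])
  have hS : S.erase 0 = (Finset.univ.erase 0).map ⟨D.emb, D.emb_injective⟩ := by
    rw [Finset.map_erase]; simp [S]
  rw [hS, Finset.prod_map] at hprod
  have hprod' : v (algebraMap Fq[X] E l) =
      ∏ y ∈ (Finset.univ.filter (· ∈ U)).erase 0, v (D.emb y) := by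
    rw [hprod]
    refine (Finset.prod_subset (Finset.erase_subset_erase _ (Finset.filter_subset _ _)) ?_).symm
    intro y hy hyU
    refine le_antisymm (hint y) (not_lt.1 fun h => hyU ?_)
    exact Finset.mem_erase.2 ⟨Finset.ne_of_mem_erase hy, Finset.mem_filter.2 ⟨Finset.mem_univ _, h⟩⟩
  have hU : U ≠ ⊥ := by
    intro h
    refine hl1.ne (hprod'.trans (Finset.prod_eq_one fun y hy => ?_))
    rw [h] at hy
    simp at hy
  obtain ⟨x₀, hx₀U, hx₀⟩ := (Submodule.ne_bot_iff U).1 hU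
  obtain ⟨j, hj, hpow⟩ := exists_pow_eq_of_valuation_lt_one v hφ hcard hr hX hlm hl1 hl0 hunit
  have hval (y) (hy : y ∈ U) (hy0 : y ≠ 0) : v (D.emb y) = v (D.emb x₀) := by
    refine (pow_left_inj₀ zero_le zero_le hj).1 ?_
    rw [← hpow _ (D.emb_eq_zero.not.2 hy0) (D.phi_emb y) hy,
      ← hpow _ (D.emb_eq_zero.not.2 hx₀) (D.phi_emb x₀) hx₀U]
  refine D.exists_det_eq hcard hcK hl.natDegree_pos.ne' U hU
    ((v.ne_zero_iff).2 (D.emb_eq_zero.not.2 hx₀)) hval hinert (fun σ hσ y => ?_) (hI (D.emb x₀) _ ?_) a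
  · rw [hUmem, map_sub, D.emb_rep]
    exact hinert σ hσ _ (hint y)
  · rw [hprod', Finset.prod_congr rfl fun y hy => hval y
        (by simpa using Finset.mem_of_mem_erase hy) (Finset.ne_of_mem_erase hy),
      Finset.prod_const, Finset.card_erase_of_mem (by simp), Nat.card_eq_fintype_card,
      Fintype.card_subtype]

/-- The Galois representation on the `𝔩`-torsion is surjective. -/
theorem rep_surjective [IsScalarTower Fq[X] (RatFunc Fq) E] [FiniteDimensional (RatFunc Fq) E]
    [IsGalois (RatFunc Fq) E] (hq : 3 ≤ q) (hl : Irreducible l) (hlX : l ≠ X)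
    (hcV : Nat.card V ≤ q ^ (r * l.natDegree)) : Function.Surjective D.rep := by
  have hinj : Function.Injective (algebraMap Fq[X] E) := by
    rw [IsScalarTower.algebraMap_eq Fq[X] (RatFunc Fq) E]
    exact (algebraMap (RatFunc Fq) E).injective.comp (IsFractionRing.injective _ _)
  have hXl : ¬ X ∣ l := fun h =>
    hlX (eq_of_monic_of_associated monic_X hlm (irreducible_X.associated_of_dvd hl h)).symm
  have hlX' : ¬ l ∣ X := fun h =>
    hlX (eq_of_monic_of_associated hlm monic_X (hl.associated_of_dvd irreducible_X h))
  obtain ⟨v, I, hunit, hX, -, hI, hinert⟩ := exists_valuation_inertia (E := E) (irreducible_X (R := Fq))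
  intro g
  by_cases hex : ∃ y, 1 < v (D.emb y)
  · obtain ⟨f, hf, htrans⟩ := D.exists_transvections hφ hcard hq hr hl hcV hcK hX (hunit l hXl)
      hI hinert hex
    obtain ⟨w, J, hw, hw1, hw0, hJ, hwinert⟩ := exists_valuation_inertia (E := E) hl
    refine mem_of_transvections_along D.rep.range f htrans (fun M hM hMf => ?_)
      (D.exists_det_eq_of_valuation hφ hcard hr hlm hcK hsplit hl hinj (hw X hlX') hw hw1 hw0 hJ
        hwinert fun y => valuation_le_one_of_phi_eq_zero w hφ hq hr (hw X hlX') hl.ne_zero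
          (D.phi_emb y)) g
    exact D.stable_eq_bot hφ hq hr hl v hX hunit M (fun σ => hM _ ⟨σ, rfl⟩)
      fun y hy => (hf y).1 (hMf hy)
  · have h := D.stable_eq_bot hφ hq hr hl v hX hunit ⊤ (fun _ _ _ => trivial)
      fun y _ => not_lt.1 fun h => hex ⟨y, h⟩
    have : Subsingleton V := (Submodule.subsingleton_iff K).1 (subsingleton_of_bot_eq_top h.symm)
    exact ⟨1, by ext y; exact Subsingleton.elim _ _⟩

end Surjective
end TorsionModel

section Torsion

variable {Fq : Type} {E : Type*} [Field Fq] [Field E]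
    [Algebra Fq[X] E] {q r : ℕ} (φ : Fq[X] →+* AddMonoid.End E) (l : Fq[X])

/-- The kernel of `φ_l` as a subgroup. -/
abbrev torsionSubgroup : AddSubgroup E := (φ l).ker

/-- The action of `𝔽_q[T]` on the `l`-torsion. -/
def torsionAction : Fq[X] →+* AddMonoid.End (torsionSubgroup φ l) where
  toFun a := ((φ a).comp (torsionSubgroup φ l).subtype).codRestrict _
    fun x => phi_phi_eq_zero (AddMonoidHom.mem_ker.1 x.2) a
  map_one' := by ext x; exact phi_one (φ := φ) (x : E)
  map_zero' := by ext x; exact phi_zero (φ := φ) (x : E)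
  map_add' a b := by ext x; exact phi_add (φ := φ) a b (x : E)
  map_mul' a b := by ext x; exact phi_mul (φ := φ) a b (x : E)

theorem coe_torsionAction (a : Fq[X]) (x : torsionSubgroup φ l) :
    (torsionAction φ l a x : E) = φ a x := rfl

/-- The `l`-torsion is a module over `𝔽_q[T]/(l)`. -/
instance torsionModule : Module (Fq[X] ⧸ Ideal.span {l}) (torsionSubgroup φ l) :=
  Module.compHom _ (Ideal.Quotient.lift (Ideal.span {l}) (torsionAction φ l) (by
    intro a ha
    obtain ⟨b, rfl⟩ := Ideal.mem_span_singleton.1 ha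
    ext x
    have hx : φ l (x : E) = 0 := x.2
    rw [coe_torsionAction, mul_comm, phi_mul, hx, map_zero]
    rfl))

variable [Algebra (RatFunc Fq) E] [IsScalarTower Fq[X] (RatFunc Fq) E]

variable {φ l} in
theorem galois_phi (hφ : IsDrinfeldOn q r φ) (σ : E ≃ₐ[RatFunc Fq] E) (a : Fq[X]) (x : E) :
    σ (φ a x) = φ a (σ x) := by
  rw [← aeval_phiPoly hφ, ← aeval_phiPoly hφ]
  exact (aeval_algHom_apply ((σ : E →ₐ[RatFunc Fq] E).restrictScalars Fq[X]) x _).symm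

/-- The Galois action on the `l`-torsion. -/
def torsionGaloisAction (hφ : IsDrinfeldOn q r φ) :
    (E ≃ₐ[RatFunc Fq] E) →* Module.End (Fq[X] ⧸ Ideal.span {l}) (torsionSubgroup φ l) where
  toFun σ :=
    { toFun := fun x => ⟨σ x,
        (galois_phi hφ σ l x).symm.trans ((congrArg σ x.2).trans (map_zero σ))⟩
      map_add' := fun x y => by ext; simp
      map_smul' := fun c x => by
        obtain ⟨a, rfl⟩ := Ideal.Quotient.mk_surjective c
        exact Subtype.ext (galois_phi hφ σ a x) }
  map_one' := by ext; rfl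
  map_mul' σ τ := by ext; rfl

attribute [local instance] Ideal.Quotient.field in
/-- The torsion module of a Drinfeld module over the field it generates. -/
def torsionModel (hφ : IsDrinfeldOn q r φ) [(Ideal.span {l}).IsMaximal]
    [IsSplittingField (RatFunc Fq) E ((phiPoly q r l).map (algebraMap Fq[X] (RatFunc Fq)))] :
    TorsionModel φ l (Fq[X] ⧸ Ideal.span {l}) (torsionSubgroup φ l) where
  red := Ideal.Quotient.mk _
  red_surjective := Ideal.Quotient.mk_surjective
  red_eq_zero_iff a := by rw [Ideal.Quotient.eq_zero_iff_mem, Ideal.mem_span_singleton]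
  emb := (torsionSubgroup φ l).subtype
  emb_injective := Subtype.val_injective
  mem_range_iff x := ⟨fun h => ⟨⟨x, h⟩, rfl⟩, by rintro ⟨y, rfl⟩; exact y.2⟩
  emb_smul a y := rfl
  rep := (LinearMap.GeneralLinearGroup.generalLinearEquiv _ _).toMonoidHom.comp
    (torsionGaloisAction φ l hφ).toHomUnits
  emb_rep σ y := rfl
  rep_injective σ τ h := by
    have h1 (x : E) (hx : φ l x = 0) : σ x = τ x :=
      congrArg (fun g : torsionSubgroup φ l ≃ₗ[Fq[X] ⧸ Ideal.span {l}] torsionSubgroup φ l =>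
        (g ⟨x, hx⟩ : E)) h
    have h2 : (σ : E →ₐ[RatFunc Fq] E) = τ := by
      refine AlgHom.ext_of_adjoin_eq_top (IsSplittingField.adjoin_rootSet E
        ((phiPoly q r l).map (algebraMap Fq[X] (RatFunc Fq)))) fun x hx => h1 x ?_
      have := (mem_rootSet'.1 hx).2
      rwa [aeval_map_algebraMap, aeval_phiPoly hφ] at this
    exact AlgEquiv.ext fun x => congrArg (fun f : E →ₐ[RatFunc Fq] E => f x) h2

attribute [local instance] Ideal.Quotient.field in
theorem exists_galois_eq [Fintype Fq] (hφ : IsDrinfeldOn q r φ) (hcard : Fintype.card Fq = q)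
    (hq : 3 ≤ q) (hr : 2 ≤ r) (hlm : l.Monic) (hl : Irreducible l) (hlX : l ≠ X)
    [IsSplittingField (RatFunc Fq) E ((phiPoly q r l).map (algebraMap Fq[X] (RatFunc Fq)))]
    (g : torsionSubgroup φ l ≃+ torsionSubgroup φ l)
    (hg : ∀ a x, g (torsionAction φ l a x) = torsionAction φ l a (g x)) :
    ∃ σ : E ≃ₐ[RatFunc Fq] E, ∀ x : torsionSubgroup φ l, σ x = g x := by
  have hmax : (Ideal.span {l}).IsMaximal :=
    PrincipalIdealRing.isMaximal_of_irreducible hl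
  have hq1 : (q : Fq) = 0 := by rw [← hcard, FiniteField.cast_card_eq_zero]
  set P := (phiPoly q r l).map (algebraMap Fq[X] (RatFunc Fq)) with hP
  have hsep : P.Separable := separable_map_phiPoly hq1 hr (IsFractionRing.injective _ _) hl.ne_zero
  have : FiniteDimensional (RatFunc Fq) E := IsSplittingField.finiteDimensional E P
  have : IsGalois (RatFunc Fq) E := IsGalois.of_separable_splitting_field hsep
  have hmap : P.map (algebraMap (RatFunc Fq) E) = (phiPoly q r l).map (algebraMap Fq[X] E) := by
    rw [hP, Polynomial.map_map, ← IsScalarTower.algebraMap_eq]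
  have hroot : ((torsionSubgroup φ l : AddSubgroup E) : Set E) = P.rootSet E := by
    ext x
    rw [mem_rootSet_of_ne hsep.ne_zero, hP, aeval_map_algebraMap, aeval_phiPoly hφ]
    rfl
  have hfin : Finite (torsionSubgroup φ l) := by
    have : Finite (P.rootSet E) := inferInstance
    rw [← hroot] at this
    exact this
  have hcV : Nat.card (torsionSubgroup φ l) ≤ q ^ (r * l.natDegree) := by
    have h1 : (P.rootSet E).ncard ≤ P.natDegree := ncard_rootSet_le P E
    rw [← hroot] at h1
    refine h1.trans (natDegree_map_le.trans ?_)
    exact (natDegree_phiPoly_leadingCoeff (by omega) (by omega) hlm).1.le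
  have hfinK : Module.Finite Fq (AdjoinRoot l) := (AdjoinRoot.powerBasis hl.ne_zero).finite
  have hK : Finite (Fq[X] ⧸ Ideal.span {l}) := Module.finite_of_finite Fq (M := AdjoinRoot l)
  have hcK : Nat.card (Fq[X] ⧸ Ideal.span {l}) = q ^ l.natDegree := by
    rw [← hcard, ← Nat.card_eq_fintype_card, ← finrank_quotient_span_eq_natDegree (f := l)]
    exact Module.natCard_eq_pow_finrank (K := Fq)
  let g' : torsionSubgroup φ l ≃ₗ[Fq[X] ⧸ Ideal.span {l}] torsionSubgroup φ l :=
    { g with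
      map_smul' := fun c x => by
        obtain ⟨a, rfl⟩ := Ideal.Quotient.mk_surjective c
        exact hg a x }
  obtain ⟨σ, hσ⟩ := (torsionModel φ l hφ).rep_surjective hφ hcard hr hlm hcK
    (hmap ▸ IsSplittingField.splits E P) hq hl hlX hcV g'
  refine ⟨σ, fun x => ?_⟩
  have h := (torsionModel φ l hφ).emb_rep σ x
  rw [hσ] at h
  exact h.symm

end Torsion

section Restriction

variable {Fq : Type} {L : Type*} [Field Fq] [Field L] [Algebra Fq[X] L] [Algebra (RatFunc Fq) L]
    [IsScalarTower Fq[X] (RatFunc Fq) L] {q r : ℕ} {φ : Fq[X] →+* AddMonoid.End L}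

theorem phi_mem_intermediateField (hφ : IsDrinfeldOn q r φ) (E : IntermediateField (RatFunc Fq) L)
    (a : Fq[X]) (x : E) : φ a x ∈ E := by
  rw [← aeval_phiPoly hφ]
  have h := aeval_algHom_apply (E.val.restrictScalars Fq[X]) x (phiPoly q r a)
  exact h ▸ (aeval x (phiPoly q r a)).2

/-- The restriction of a Drinfeld module to an intermediate field. -/
def restrictPhi (hφ : IsDrinfeldOn q r φ) (E : IntermediateField (RatFunc Fq) L) :
    Fq[X] →+* AddMonoid.End E where
  toFun a :=
    { toFun := fun x => ⟨φ a x, phi_mem_intermediateField hφ E a x⟩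
      map_zero' := Subtype.ext (map_zero (φ a))
      map_add' := fun x y => Subtype.ext (map_add (φ a) (x : L) y) }
  map_one' := AddMonoidHom.ext fun x => Subtype.ext (phi_one (φ := φ) (x : L))
  map_zero' := AddMonoidHom.ext fun x => Subtype.ext (phi_zero (φ := φ) (x : L))
  map_add' a b := AddMonoidHom.ext fun x => Subtype.ext (phi_add (φ := φ) a b (x : L))
  map_mul' a b := AddMonoidHom.ext fun x => Subtype.ext (phi_mul (φ := φ) a b (x : L))

theorem isDrinfeldOn_restrictPhi (hφ : IsDrinfeldOn q r φ) (E : IntermediateField (RatFunc Fq) L) :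
    IsDrinfeldOn q r (restrictPhi hφ E) :=
  ⟨fun c x => Subtype.ext (hφ.1 c x), fun x => Subtype.ext (hφ.2 x)⟩

theorem exists_algEquiv_eq [IsAlgClosed L] [Algebra.IsAlgebraic (RatFunc Fq) L] [Fintype Fq]
    (hφ : IsDrinfeldOn q r φ) (hcard : Fintype.card Fq = q)
    (hq : 3 ≤ q) (hr : 2 ≤ r) {l : Fq[X]} (hlm : l.Monic) (hl : Irreducible l) (hlX : l ≠ X)
    {g : L → L} (hbij : Set.BijOn g {x | φ l x = 0} {x | φ l x = 0})
    (hadd : ∀ x ∈ {x | φ l x = 0}, ∀ y ∈ {x | φ l x = 0}, g (x + y) = g x + g y)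
    (hcomm : ∀ b, ∀ x ∈ {x | φ l x = 0}, g (φ b x) = φ b (g x)) :
    ∃ σ : L ≃ₐ[RatFunc Fq] L, ∀ x ∈ {x | φ l x = 0}, σ x = g x := by
  set P := (phiPoly q r l).map (algebraMap Fq[X] (RatFunc Fq)) with hP
  have hq1 : (q : Fq) = 0 := by rw [← hcard, FiniteField.cast_card_eq_zero]
  have hsep : P.Separable := separable_map_phiPoly hq1 hr (IsFractionRing.injective _ _) hl.ne_zero
  let E := IntermediateField.adjoin (RatFunc Fq) (P.rootSet L)
  have hsplit : IsSplittingField (RatFunc Fq) E P :=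
    IntermediateField.adjoin_rootSet_isSplittingField (IsAlgClosed.splits _)
  have hnormal : Normal (RatFunc Fq) E := Normal.of_isSplittingField P
  have hmem {x : L} (hx : φ l x = 0) : x ∈ E := by
    refine IntermediateField.subset_adjoin _ _ ?_
    rw [mem_rootSet_of_ne hsep.ne_zero, hP, aeval_map_algebraMap, aeval_phiPoly hφ]
    exact hx
  have hcoe (x : torsionSubgroup (restrictPhi hφ E) l) : φ l (x : E) = 0 :=
    congrArg Subtype.val x.2
  let g₀ : torsionSubgroup (restrictPhi hφ E) l →+ torsionSubgroup (restrictPhi hφ E) l :=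
    AddMonoidHom.mk' (fun x => ⟨⟨g x, hmem (hbij.mapsTo (hcoe x))⟩,
        Subtype.ext (hbij.mapsTo (hcoe x))⟩)
      fun x y => Subtype.ext (Subtype.ext (hadd _ (hcoe x) _ (hcoe y)))
  have hg₀ : Function.Bijective g₀ := by
    refine ⟨fun x y h => Subtype.ext (Subtype.ext (hbij.injOn (hcoe x) (hcoe y) ?_)), fun y => ?_⟩
    · exact congrArg (fun z : torsionSubgroup (restrictPhi hφ E) l => ((z : E) : L)) h
    · obtain ⟨x, hx, hxy⟩ := hbij.surjOn (hcoe y)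
      exact ⟨⟨⟨x, hmem hx⟩, Subtype.ext hx⟩, Subtype.ext (Subtype.ext hxy)⟩
  obtain ⟨σ, hσ⟩ := exists_galois_eq (restrictPhi hφ E) l (isDrinfeldOn_restrictPhi hφ E) hcard hq
    hr hlm hl hlX (AddEquiv.ofBijective g₀ hg₀)
    fun a x => Subtype.ext (Subtype.ext (hcomm a _ (hcoe x)))
  have : IsAlgClosure (RatFunc Fq) L := ⟨‹_›, ‹_›⟩
  have : Normal (RatFunc Fq) L := IsAlgClosure.normal (RatFunc Fq) L
  obtain ⟨τ, rfl⟩ := AlgEquiv.restrictNormalHom_surjective (F := RatFunc Fq) (K₁ := E) L σ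
  refine ⟨τ, fun x hx => ?_⟩
  have h := congrArg (algebraMap E L) (hσ ⟨⟨x, hmem hx⟩, Subtype.ext hx⟩)
  exact (AlgEquiv.restrictNormal_commutes τ E _).symm.trans h

end Restriction

/-- There is `c = c(r)` such that for `p > c`: for every nonzero prime `𝔩 = (l) ≠ (T)`,
the mod `𝔩` representation of `φ` is surjective: every `𝔽_𝔩`-linear automorphism of
`φ[𝔩]` is the restriction of some `σ ∈ Gal(F̄/F)`. -/
theorem mod_l_galois_representation_surjective (r : ℕ) (hr : r.Prime) (hr3 : 3 ≤ r) :
    ∃ c : ℕ, ∀ (p e q : ℕ), p.Prime → 5 ≤ p → c < p → 0 < e → q = p ^ e →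
    ∀ (Fq : Type) [Field Fq] [Fintype Fq], Fintype.card Fq = q →
    ∀ φ : Polynomial Fq →+* AddMonoid.End (Kbar Fq), IsDrinfeldPhi Fq q r φ →
    ∀ l : Polynomial Fq, l.Monic → Irreducible l → l ≠ X →
    ∀ g : Kbar Fq → Kbar Fq, IsTorsionAut Fq φ l g →
    ∃ σ : Kbar Fq ≃ₐ[RatFunc Fq] Kbar Fq, ∀ x ∈ phiTorsion Fq φ l, σ x = g x := by
  refine ⟨0, fun p e q hp hp5 _ he hq Fq _ _ hcard φ hφ l hlm hl hlX g hg => ?_⟩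
  have hq5 : p ≤ q := hq ▸ Nat.le_self_pow he.ne' p
  have hφ' : IsDrinfeldOn q r φ := by
    refine ⟨fun c x => ?_, fun x => ?_⟩
    · rw [IsScalarTower.algebraMap_apply Fq[X] (RatFunc Fq) (Kbar Fq), RatFunc.algebraMap_C]
      exact hφ.1 c x
    · rw [IsScalarTower.algebraMap_apply Fq[X] (RatFunc Fq) (Kbar Fq), RatFunc.algebraMap_X]
      exact hφ.2 x
  exact exists_algEquiv_eq hφ' hcard (by omega) (by omega) hlm hl hlX hg.1 hg.2.1 hg.2.2
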